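/- arXiv:2301.00208 — 3 statements merged into one kernel-verified Lean document; each statement's English description precedes it below -/
import Mathlib

section
/- Let B be a unital complex Banach algebra, A a unital C*-algebra with a faithful tracial state τ, and T : B → A a surjective unital linear mapping which preserves invertible elements. Then τ(T(a² b) + (T a)² T b + T b (T a)² − T(a²) T b − 2 T(a b) T a) = 0 for all a, b ∈ B. -/
open scoped ComplexOrder

theorem aux_tau_clm {A : Type*} [CStarAlgebra A] (τ : A →ₗ[ℂ] ℂ)
    (hτpos : ∀ a : A, 0 ≤ τ (star a * a)) :
    (∃ t : A →L[ℂ] ℂ, ∀ a, t a = τ a) ∧ ∀ a, τ (star a) = star (τ a) := by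
  let _ := CStarAlgebra.spectralOrder A
  have _ := CStarAlgebra.spectralOrderedRing A
  have hp : ∀ a : A, 0 ≤ a → 0 ≤ τ a := by
    intro a ha
    obtain ⟨s, rfl⟩ := CStarAlgebra.nonneg_iff_eq_star_mul_self.mp ha
    exact hτpos s
  let f : A →ₚ[ℂ] ℂ := PositiveLinearMap.mk₀ τ hp
  refine ⟨?_, ?_⟩
  · obtain ⟨C, hC⟩ := f.exists_norm_apply_le
    exact ⟨LinearMap.mkContinuous τ C hC, fun a => rfl⟩
  · intro a
    exact map_star f a

/-- positivity package for `1 - M⁻¹ X*X`. -/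
theorem aux_y {A : Type*} [CStarAlgebra A] [Nontrivial A] (τ : A →L[ℂ] ℂ)
    (hτpos : ∀ a : A, 0 ≤ τ (star a * a)) (X : A) (hX : IsUnit X) (m : ℝ) (hm : 0 < m)
    (hXm : ‖X‖ ≤ m) :
    ‖1 - ((m^2)⁻¹ : ℝ) • (star X * X)‖ < 1 ∧
      ∀ k : ℕ, 0 ≤ τ ((1 - ((m^2)⁻¹ : ℝ) • (star X * X)) ^ k) := by
  let _ := CStarAlgebra.spectralOrder A
  have _ := CStarAlgebra.spectralOrderedRing A
  have hp : ∀ a : A, 0 ≤ a → 0 ≤ τ a := by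
    intro a ha
    obtain ⟨s, rfl⟩ := CStarAlgebra.nonneg_iff_eq_star_mul_self.mp ha
    exact hτpos s
  set H := star X * X with hH
  have hsp : IsStrictlyPositive H := by
    have := (hX.isStrictlyPositive_star_left_conjugate_iff (a := (1:A))).mpr (isStrictlyPositive_one)
    simpa using this
  obtain ⟨r, hr, hr_le⟩ : ∃ r > 0, (algebraMap ℝ A) r ≤ H :=
    (CFC.exists_pos_algebraMap_le_iff hsp.isSelfAdjoint).2 fun x hx ↦ hsp.spectrum_pos hx
  have hHn : ‖H‖ ≤ m^2 := by
    rw [hH, CStarRing.norm_star_mul_self]; nlinarith [norm_nonneg X]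
  have hle : H ≤ algebraMap ℝ A (m^2) :=
    (CStarAlgebra.norm_le_iff_le_algebraMap H (by positivity) hsp.nonneg).mp hHn
  have hm2 : 0 < (m^2)⁻¹ := by positivity
  have h1 : ((m^2)⁻¹ : ℝ) • H ≤ 1 := by
    have := smul_le_smul_of_nonneg_left hle hm2.le
    rwa [Algebra.algebraMap_eq_smul_one, smul_smul, inv_mul_cancel₀ (by positivity), one_smul] at this
  have hy0 : 0 ≤ 1 - ((m^2)⁻¹ : ℝ) • H := sub_nonneg.mpr h1
  have h2 : 1 - ((m^2)⁻¹ : ℝ) • H ≤ algebraMap ℝ A (1 - (m^2)⁻¹ * r) := by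
    have := smul_le_smul_of_nonneg_left hr_le hm2.le
    rw [Algebra.algebraMap_eq_smul_one, smul_smul] at this
    rw [Algebra.algebraMap_eq_smul_one, sub_smul, one_smul]
    exact sub_le_sub_left this 1
  have hrm : r ≤ m^2 := by
    have := hr_le.trans hle
    exact (algebraMap_le_algebraMap (α := ℝ) (β := A)).mp this
  have h3 : 0 ≤ 1 - (m^2)⁻¹ * r := by
    rw [sub_nonneg, inv_mul_le_iff₀ (by positivity)]; linarith
  refine ⟨?_, fun k => hp _ (CStarAlgebra.pow_nonneg hy0 k)⟩
  have := (CStarAlgebra.norm_le_iff_le_algebraMap _ h3 hy0).mpr h2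
  have : 0 < (m^2)⁻¹ * r := by positivity
  linarith

theorem aux_pow_fderiv {A : Type*} [CStarAlgebra A] (τ : A →L[ℂ] ℂ)
    (htr : ∀ a b : A, τ (a * b) = τ (b * a)) (k : ℕ) (y : A) :
    HasFDerivAt (𝕜 := ℝ) (fun y : A => ((k:ℂ)+1)⁻¹ * τ (y ^ (k+1)))
      ((τ.restrictScalars ℝ).comp (ContinuousLinearMap.mul ℝ A (y ^ k))) y := by
  have key : ∀ k : ℕ, ∃ D : A →L[ℝ] A, HasFDerivAt (𝕜 := ℝ) (fun y : A => y ^ k) D y ∧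
      ∀ v j, τ (y ^ j * D v) * 1 = k * τ (y ^ (k - 1 + j) * v) := by
    intro k
    induction k with
    | zero => exact ⟨0, by simpa using hasFDerivAt_const (1:A) y, by simp⟩
    | succ k ih =>
      obtain ⟨D, hD, hDτ⟩ := ih
      have hm : HasFDerivAt (𝕜 := ℝ) (fun y : A => y ^ k * y) _ y := hD.mul' (hasFDerivAt_id y)
      simp only [← pow_succ] at hm
      refine ⟨_, hm, ?_⟩
      intro v j
      have e1 : τ (y ^ j * (D v * y)) = τ (y ^ (j+1) * D v) := by
        rw [← mul_assoc, htr, ← mul_assoc, pow_succ']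
      have e2 := hDτ v (j+1)
      rcases k with _ | k
      · simp at *
        simp [mul_add, e1, e2]
      · simp [mul_add, e1] at *
        rw [e2, ← mul_assoc, ← pow_add]
        rw [show k + (j+1) = k+1+j by ring, show j + (k+1) = k+1+j by ring]
        ring
  obtain ⟨D, hD, hDτ⟩ := key (k+1)
  have h := ((τ.restrictScalars ℝ).hasFDerivAt.comp y hD).const_mul (((k:ℂ)+1)⁻¹)
  refine h.congr_fderiv ?_
  ext v
  have := hDτ v 0
  simp at this
  have hk : (k:ℂ)+1 ≠ 0 := by exact_mod_cast Nat.succ_ne_zero k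
  simp [this]
  field_simp

theorem aux_log_fderiv {A : Type*} [CStarAlgebra A] [Nontrivial A] (τ : A →L[ℂ] ℂ)
    (htr : ∀ a b : A, τ (a * b) = τ (b * a)) (y : A) (hy : ‖y‖ < 1) :
    HasFDerivAt (𝕜 := ℝ) (fun y : A => ∑' k : ℕ, ((k:ℂ)+1)⁻¹ * τ (y ^ (k+1)))
      ((τ.restrictScalars ℝ).comp (ContinuousLinearMap.mul ℝ A (Ring.inverse (1 - y)))) y := by
  obtain ⟨q, hyq, hq1⟩ := exists_between hy
  have hq0 : 0 ≤ q := (norm_nonneg y).trans hyq.le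
  have hsum : Summable (fun k : ℕ => ‖τ‖ * q ^ k) :=
    (summable_geometric_of_lt_one hq0 hq1).mul_left _
  have h := hasFDerivAt_tsum_of_isPreconnected (𝕜 := ℝ)
    (f := fun (k : ℕ) (y : A) => ((k:ℂ)+1)⁻¹ * τ (y ^ (k+1)))
    (f' := fun k y => (τ.restrictScalars ℝ).comp (ContinuousLinearMap.mul ℝ A (y ^ k)))
    (s := Metric.ball (0:A) q) (x₀ := 0) (x := y) hsum Metric.isOpen_ball
    (convex_ball _ _).isPreconnected (fun k x _ => aux_pow_fderiv τ htr k x)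
    (fun k x hx => by
      refine ContinuousLinearMap.opNorm_le_bound _ (by positivity) fun v => ?_
      have hx' : ‖x‖ ≤ q := by simpa using (mem_ball_zero_iff.mp hx).le
      calc ‖τ (x ^ k * v)‖ ≤ ‖τ‖ * ‖x ^ k * v‖ := τ.le_opNorm _
        _ ≤ ‖τ‖ * (‖x‖ ^ k * ‖v‖) := by
          gcongr
          exact (norm_mul_le _ _).trans (by gcongr; exact norm_pow_le x k)
        _ ≤ ‖τ‖ * (q ^ k * ‖v‖) := by gcongr
        _ = ‖τ‖ * q ^ k * ‖v‖ := by ring)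
    (by simpa using lt_of_le_of_lt (norm_nonneg y) hyq) (by simp)
    (by simpa using hyq)
  refine h.congr_fderiv ?_
  have hg : Summable (fun k : ℕ => y ^ k) := summable_geometric_of_norm_lt_one hy
  have hs := hg.hasSum
  rw [← geom_series_eq_inverse y hy]
  have := ((ContinuousLinearMap.compL ℝ A A ℂ (τ.restrictScalars ℝ)).comp
    (ContinuousLinearMap.mul ℝ A)).hasSum hs
  exact this.tsum_eq

theorem aux_path {A : Type*} [CStarAlgebra A] [Nontrivial A] (τ : A →L[ℂ] ℂ)
    (h1 : τ 1 = 1)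
    (htr : ∀ a b : A, τ (a * b) = τ (b * a))
    (hpos : ∀ a : A, 0 ≤ τ (star a * a))
    (hstar : ∀ a, τ (star a) = star (τ a))
    (X X' : ℝ → A) (hX : ∀ t ∈ Set.Icc (0:ℝ) 1, HasDerivAt X (X' t) t)
    (hu : ∀ t ∈ Set.Icc (0:ℝ) 1, IsUnit (X t)) (hX0 : X 0 = 1)
    (m : ℝ) (hm : ∀ t ∈ Set.Icc (0:ℝ) 1, ‖X t‖ ≤ m)
    (ψ : ℝ → ℝ) (hψ0 : ψ 0 = 0)
    (hψ : ∀ t ∈ Set.Icc (0:ℝ) 1, HasDerivAt ψ (τ (Ring.inverse (X t) * X' t)).re t) :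
    ψ 1 ≤ Real.log m := by
  have hm1 : 1 ≤ m := by simpa [hX0] using hm 0 (by simp)
  have hm0 : 0 < m := by linarith
  set L : A → ℂ := fun y : A => ∑' k : ℕ, ((k:ℂ)+1)⁻¹ * τ (y ^ (k+1)) with hL
  set Y : ℝ → A := fun t => 1 - ((m^2)⁻¹ : ℝ) • (star (X t) * X t) with hY
  have hYn : ∀ t ∈ Set.Icc (0:ℝ) 1, ‖Y t‖ < 1 := fun t ht =>
    (aux_y τ hpos (X t) (hu t ht) m hm0 (hm t ht)).1
  have hd : ∀ t ∈ Set.Icc (0:ℝ) 1, HasDerivAt (fun t => 2 * ψ t + (L (Y t)).re) 0 t := by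
    intro t ht
    have hYd : HasDerivAt Y (- (((m^2)⁻¹ : ℝ) • (star (X' t) * X t + star (X t) * X' t))) t := by
      have := (((hX t ht).star.mul (hX t ht)).const_smul ((m^2)⁻¹ : ℝ)).const_sub (1:A)
      exact this
    have hLd := (aux_log_fderiv τ htr (Y t) (hYn t ht)).comp_hasDerivAt t hYd
    have hre := (Complex.reCLM.hasFDerivAt.comp_hasDerivAt t hLd)
    have htot := ((hψ t ht).const_mul 2).add hre
    refine htot.congr_deriv ?_
    obtain ⟨u, huX⟩ := hu t ht
    have e0 : 1 - Y t = ((m^2)⁻¹ : ℝ) • (star (X t) * X t) := by simp [hY]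
    have e1 : Ring.inverse (1 - Y t) = (m^2 : ℝ) • ((↑u⁻¹ : A) * star (↑u⁻¹ : A)) := by
      rw [e0, ← huX]
      have hs1 : star (u:A) * star (↑u⁻¹ : A) = 1 := by rw [← star_mul]; simp
      have hs2 : star (↑u⁻¹ : A) * star (u:A) = 1 := by rw [← star_mul]; simp
      have hi1 : (((m^2)⁻¹ : ℝ) • (star (u:A) * u)) *
          ((m^2 : ℝ) • ((↑u⁻¹ : A) * star (↑u⁻¹ : A))) = 1 := by
        rw [smul_mul_smul_comm, inv_mul_cancel₀ (by positivity), one_smul, mul_assoc,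
          Units.mul_inv_cancel_left, hs1]
      have hi2 : ((m^2 : ℝ) • ((↑u⁻¹ : A) * star (↑u⁻¹ : A))) *
          (((m^2)⁻¹ : ℝ) • (star (u:A) * u)) = 1 := by
        rw [smul_mul_smul_comm, mul_inv_cancel₀ (by positivity), one_smul, mul_assoc,
          ← mul_assoc (star _) (star _), hs2, one_mul, Units.inv_mul]
      exact Ring.inverse_unit ⟨_, _, hi1, hi2⟩
    have e2 : τ (Ring.inverse (1 - Y t) *
        (- (((m^2)⁻¹ : ℝ) • (star (X' t) * X t + star (X t) * X' t)))) =
        - (star (τ (Ring.inverse (X t) * X' t)) + τ (Ring.inverse (X t) * X' t)) := by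
      rw [e1, ← hstar, ← huX, Ring.inverse_unit]
      have : (m^2 : ℝ) • ((↑u⁻¹ : A) * star (↑u⁻¹ : A)) *
        (- (((m^2)⁻¹ : ℝ) • (star (X' t) * ↑u + star (↑u:A) * X' t))) =
        - ((↑u⁻¹ : A) * star (↑u⁻¹ : A) * star (X' t) * ↑u + ↑u⁻¹ * (star (↑u⁻¹ : A) * star (↑u:A)) * X' t) := by
        rw [mul_neg, smul_mul_smul_comm, mul_inv_cancel₀ (by positivity), one_smul]
        simp only [mul_add, mul_assoc]
      rw [this, map_neg, map_add, htr _ (u:A), ← star_mul]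
      simp [← mul_assoc]
      rw [htr]
    simp only [ContinuousLinearMap.comp_apply, ContinuousLinearMap.mul_apply',
      ContinuousLinearMap.coe_restrictScalars', Complex.reCLM_apply]
    rw [e2]
    simp
    ring
  have hconst : 2 * ψ 1 + (L (Y 1)).re = 2 * ψ 0 + (L (Y 0)).re := by
    have := constant_of_has_deriv_right_zero (a := 0) (b := 1)
      (f := fun t => 2 * ψ t + (L (Y t)).re)
      (fun t ht => (hd t ht).continuousAt.continuousWithinAt)
      (fun t ht => (hd t ⟨ht.1, ht.2.le⟩).hasDerivWithinAt) 1 (by simp)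
    exact this
  have hL1 : 0 ≤ (L (Y 1)).re := by
    have : 0 ≤ L (Y 1) := tsum_nonneg fun k => by
      have h := (aux_y τ hpos (X 1) (hu 1 (by simp)) m hm0 (hm 1 (by simp))).2 (k+1)
      have h2 : (0:ℂ) ≤ ((k:ℂ)+1)⁻¹ := by
        have : (0:ℝ) ≤ ((k:ℝ)+1)⁻¹ := by positivity
        simpa using Complex.zero_le_real.mpr this
      exact mul_nonneg h2 h
    exact (Complex.le_def.mp this).1
  have hL0 : (L (Y 0)).re = 2 * Real.log m := by
    set r : ℝ := 1 - (m^2)⁻¹ with hr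
    have hmi : 0 < (m^2)⁻¹ := by positivity
    have hmi1 : (m^2)⁻¹ ≤ 1 := inv_le_one_of_one_le₀ (by nlinarith)
    have hY0 : Y 0 = ((r:ℝ):ℂ) • (1:A) := by
      rw [Complex.coe_smul]
      simp [hY, hX0, hr, sub_smul]
    have h := Real.hasSum_pow_div_log_of_abs_lt_one (x := r) (by rw [abs_lt]; constructor <;> linarith)
    have h' := Complex.hasSum_ofReal.mpr h
    have : L (Y 0) = ((-Real.log (1 - r) : ℝ) : ℂ) := by
      rw [← h'.tsum_eq, hL, hY0]
      refine tsum_congr fun k => ?_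
      simp [smul_pow, h1]
      ring
    rw [this, Complex.ofReal_re, hr]
    simp
  linarith

theorem aux_powderiv {A : Type*} [CStarAlgebra A] (τ : A →L[ℂ] ℂ)
    (htr : ∀ a b : A, τ (a * b) = τ (b * a)) (F : ℝ → A) (F' : A) (t : ℝ)
    (hF : HasDerivAt F F' t) (hu : IsUnit (F t)) (k : ℕ) :
    ∃ D : A, HasDerivAt (fun s => F s ^ k) D t ∧
      τ (Ring.inverse (F t ^ k) * D) = k * τ (Ring.inverse (F t) * F') := by
  induction k with
  | zero => exact ⟨0, by simpa using hasDerivAt_const t (1:A), by simp⟩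
  | succ k ih =>
    obtain ⟨D, hD, hDτ⟩ := ih
    have hm : HasDerivAt (fun s => F s ^ k * F s) _ t := hD.mul hF
    simp only [← pow_succ] at hm
    refine ⟨_, hm, ?_⟩
    obtain ⟨u, huF⟩ := hu
    rw [← huF] at hDτ ⊢
    rw [← Units.val_pow_eq_pow_val, Ring.inverse_unit] at hDτ ⊢
    rw [Ring.inverse_unit] at hDτ ⊢
    rw [mul_add, map_add, ← Units.val_pow_eq_pow_val]
    have e1 : (↑(u ^ (k+1))⁻¹ : A) * (D * ↑u) = (↑u⁻¹ * (↑(u^k)⁻¹ * D)) * ↑u := by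
      rw [pow_succ]; simp [mul_assoc]
    have e2 : (↑(u ^ (k+1))⁻¹ : A) * (↑(u^k) * F') = ↑u⁻¹ * F' := by
      rw [pow_succ, mul_inv_rev, Units.val_mul, mul_assoc, Units.inv_mul_cancel_left]
    rw [e1, e2, htr, Units.mul_inv_cancel_left, hDτ]
    push_cast; ring

theorem aux_gelfand {A : Type*} [CStarAlgebra A] [Nontrivial A] (a : A) (ρ m : ℝ) (hρ : 0 ≤ ρ)
    (hm : ρ < m) (h : ∀ z ∈ spectrum ℂ a, ‖z‖ ≤ ρ) : ∃ j : ℕ, ‖a ^ (2 ^ j)‖ < m ^ (2 ^ j) := by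
  have hm0 : 0 < m := by linarith
  lift ρ to NNReal using hρ
  lift m to NNReal using hm0.le
  have hr : spectralRadius ℂ a < (m : ENNReal) := by
    refine lt_of_le_of_lt (b := (ρ : ENNReal)) ?_ (by exact_mod_cast hm)
    exact iSup₂_le fun z hz => by
      have := h z hz
      exact_mod_cast this
  have ht := (spectrum.pow_nnnorm_pow_one_div_tendsto_nhds_spectralRadius a).comp
    (tendsto_pow_atTop_atTop_of_one_lt (r := 2) (by norm_num : 1 < 2))
  obtain ⟨j, hj⟩ := (ht.eventually_lt_const hr).exists
  refine ⟨j, ?_⟩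
  simp only [Function.comp] at hj
  have hp : (0:ℝ) < ((2 ^ j : ℕ) : ℝ) := by positivity
  have h2 := ENNReal.rpow_lt_rpow hj hp
  rw [← ENNReal.rpow_mul, one_div, inv_mul_cancel₀ hp.ne', ENNReal.rpow_one,
    ENNReal.rpow_natCast] at h2
  exact_mod_cast h2

theorem aux_path2 {A : Type*} [CStarAlgebra A] [Nontrivial A] (τ : A →L[ℂ] ℂ)
    (h1 : τ 1 = 1)
    (htr : ∀ a b : A, τ (a * b) = τ (b * a))
    (hpos : ∀ a : A, 0 ≤ τ (star a * a))
    (hstar : ∀ a, τ (star a) = star (τ a))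
    (X X' : ℝ → A) (hX : ∀ t ∈ Set.Icc (0:ℝ) 1, HasDerivAt X (X' t) t)
    (hu : ∀ t ∈ Set.Icc (0:ℝ) 1, IsUnit (X t)) (hX0 : X 0 = 1)
    (ρ m : ℝ) (hρ : 0 ≤ ρ) (hρm : ρ < m)
    (hm : ∀ t ∈ Set.Icc (0:ℝ) 1, ∀ z ∈ spectrum ℂ (X t), ‖z‖ ≤ ρ)
    (ψ : ℝ → ℝ) (hψ0 : ψ 0 = 0)
    (hψ : ∀ t ∈ Set.Icc (0:ℝ) 1, HasDerivAt ψ (τ (Ring.inverse (X t) * X' t)).re t) :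
    ψ 1 ≤ Real.log m := by
  have hm0 : 0 < m := by linarith
  have hcont : ContinuousOn X (Set.Icc 0 1) := fun t ht => (hX t ht).continuousAt.continuousWithinAt
  rw [continuousOn_iff_continuous_domRestrict] at hcont
  have hmono : Monotone (fun j : ℕ =>
      {t : Set.Icc (0:ℝ) 1 | ‖X t ^ (2^j)‖ < m ^ (2^j)}) := by
    refine monotone_nat_of_le_succ fun j t ht => ?_
    simp only [Set.mem_ofPred_eq] at ht ⊢
    rw [pow_succ, pow_mul, pow_mul, sq, sq]
    refine (norm_mul_le _ _).trans_lt ?_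
    exact mul_lt_mul'' ht ht (norm_nonneg _) (norm_nonneg _)
  obtain ⟨j, hj⟩ := isCompact_univ.elim_directed_cover
    (fun j : ℕ => {t : Set.Icc (0:ℝ) 1 | ‖X t ^ (2^j)‖ < m ^ (2^j)})
    (fun j => isOpen_lt ((hcont.pow _).norm) continuous_const)
    (fun t _ => by
      obtain ⟨j, hj⟩ := aux_gelfand (X t) ρ m hρ hρm (hm t t.2)
      exact Set.mem_iUnion.mpr ⟨j, hj⟩)
    hmono.directed_le
  set K := 2 ^ j with hK
  have hex : ∀ t : ℝ, ∃ D : A, t ∈ Set.Icc (0:ℝ) 1 → (HasDerivAt (fun s => X s ^ K) D t ∧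
      τ (Ring.inverse (X t ^ K) * D) = K * τ (Ring.inverse (X t) * X' t)) := by
    intro t
    by_cases ht : t ∈ Set.Icc (0:ℝ) 1
    · obtain ⟨D, hD⟩ := aux_powderiv τ htr X (X' t) t (hX t ht) (hu t ht) K
      exact ⟨D, fun _ => hD⟩
    · exact ⟨0, fun h => absurd h ht⟩
  choose D hD using hex
  have := aux_path τ h1 htr hpos hstar (fun t => X t ^ K) D (fun t ht => (hD t ht).1)
    (fun t ht => (hu t ht).pow K) (by simp [hX0]) (m ^ K)
    (fun t ht => le_of_lt (hj (Set.mem_univ ⟨t, ht⟩)))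
    (fun t => K * ψ t) (by simp [hψ0])
    (fun t ht => by
      rw [(hD t ht).2]
      simpa using (hψ t ht).const_mul (K:ℝ))
  rw [Real.log_pow] at this
  have hK0 : (0:ℝ) < K := by positivity
  exact le_of_mul_le_mul_left this hK0

/-- polynomial function with coefficients `c`. -/
noncomputable def auxS {A : Type*} [CStarAlgebra A] (c : ℕ → A) (n : ℕ) (l : ℂ) : A :=
  ∑ k ∈ Finset.range n, l ^ k • c k

noncomputable def auxD {A : Type*} [CStarAlgebra A] (c : ℕ → A) : ℕ → A :=
  fun k => ((k:ℂ)+1) • c (k+1)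

theorem auxS_deriv {A : Type*} [CStarAlgebra A] (c : ℕ → A) (n : ℕ) (l : ℂ) :
    HasDerivAt (auxS c (n+1)) (auxS (auxD c) n l) l := by
  have h : HasDerivAt (fun l => ∑ k ∈ Finset.range (n+1), l ^ k • c k)
      (∑ k ∈ Finset.range (n+1), ((k:ℂ) * l ^ (k-1)) • c k) l :=
    HasDerivAt.fun_sum fun k _ => (hasDerivAt_pow k l).smul_const (c k)
  refine h.congr_deriv ?_
  rw [Finset.sum_range_succ']
  simp [auxS, auxD, smul_smul, mul_comm]

theorem auxS_zero {A : Type*} [CStarAlgebra A] (c : ℕ → A) (n : ℕ) : auxS c (n+1) 0 = c 0 := by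
  simp [auxS, Finset.sum_range_succ']

theorem aux_inv_deriv {A : Type*} [CStarAlgebra A] (F : ℂ → A) (F' : A) (l : ℂ)
    (hF : HasDerivAt F F' l) (hu : IsUnit (F l)) :
    HasDerivAt (fun z => Ring.inverse (F z))
      (-(Ring.inverse (F l) * F' * Ring.inverse (F l))) l := by
  obtain ⟨u, hu⟩ := hu
  have h := hasFDerivAt_ringInverse (𝕜 := ℂ) u
  rw [hu] at h
  have := h.comp_hasDerivAt l hF
  refine this.congr_deriv ?_
  rw [← hu, Ring.inverse_unit]
  simp

theorem aux_coeff {A : Type*} [CStarAlgebra A] [Nontrivial A] (τ : A →L[ℂ] ℂ)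
    (h1 : τ 1 = 1)
    (htr : ∀ a b : A, τ (a * b) = τ (b * a))
    (hpos : ∀ a : A, 0 ≤ τ (star a * a))
    (hstar : ∀ a, τ (star a) = star (τ a))
    (c : ℕ → A) (hc0 : c 0 = 1) (N : ℕ) (R : ℝ) (hR : 0 < R)
    (hu : ∀ l ∈ Metric.ball (0:ℂ) R, IsUnit (auxS c (N+4) l))
    (ρ m : ℝ) (hρ : 0 ≤ ρ) (hρm : ρ < m) (hm1 : 1 < m)
    (hm : ∀ l ∈ Metric.ball (0:ℂ) R, ∀ z ∈ spectrum ℂ (auxS c (N+4) l), ‖z‖ ≤ ρ) :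
    ‖τ (3 • c 3 - 3 • (c 1 * c 2) + c 1 * c 1 * c 1)‖ ≤ 48 * Real.log m / R ^ 3 := by
  set F := auxS c (N+4) with hF
  set F1 := auxS (auxD c) (N+3) with hF1
  set F2 := auxS (auxD (auxD c)) (N+2) with hF2
  set F3 := auxS (auxD (auxD (auxD c))) (N+1) with hF3
  have dF : ∀ l, HasDerivAt F (F1 l) l := fun l => auxS_deriv c (N+3) l
  have dF1 : ∀ l, HasDerivAt F1 (F2 l) l := fun l => auxS_deriv _ (N+2) l
  have dF2 : ∀ l, HasDerivAt F2 (F3 l) l := fun l => auxS_deriv _ (N+1) l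
  have eF : F 0 = 1 := by rw [hF, auxS_zero, hc0]
  have eF1 : F1 0 = c 1 := by rw [hF1, auxS_zero]; simp [auxD]
  have eF2 : F2 0 = (2:ℂ) • c 2 := by
    rw [hF2, auxS_zero]; simp [auxD]; norm_num
  have eF3 : F3 0 = (6:ℂ) • c 3 := by
    rw [hF3, auxS_zero]; simp [auxD, smul_smul]; norm_num
  set I : ℂ → A := fun l => Ring.inverse (F l) with hI
  have dI : ∀ l ∈ Metric.ball (0:ℂ) R, HasDerivAt I (-(I l * F1 l * I l)) l :=
    fun l hl => aux_inv_deriv F _ l (dF l) (hu l hl)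
  have eI : I 0 = 1 := by simp [hI, eF]
  set h : ℂ → ℂ := fun l => τ (I l * F1 l) with hh
  have dh : ∀ l ∈ Metric.ball (0:ℂ) R, HasDerivAt h
      (τ (-(I l * F1 l * I l) * F1 l + I l * F2 l)) l := fun l hl =>
    τ.hasFDerivAt.comp_hasDerivAt l ((dI l hl).mul (dF1 l))
  have hex : Complex.IsExactOn h (Metric.ball 0 R) :=
    DifferentiableOn.isExactOn_ball
      (fun l hl => (dh l hl).differentiableAt.differentiableWithinAt)
  obtain ⟨g, hg0, hg⟩ := hex.with_val_at 0 0
  have hmem0 : (0:ℂ) ∈ Metric.ball (0:ℂ) R := by simpa using hR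
  have hlog : 0 < Real.log m := Real.log_pos hm1
  have hre : Set.MapsTo g (Metric.ball 0 R) {z | z.re ≤ Real.log m} := by
    intro l hl
    have hseg : ∀ t ∈ Set.Icc (0:ℝ) 1, (t:ℂ) * l ∈ Metric.ball (0:ℂ) R := by
      intro t ht
      rw [mem_ball_zero_iff] at hl ⊢
      rw [norm_mul, Complex.norm_real, Real.norm_of_nonneg ht.1]
      nlinarith [norm_nonneg l, ht.2]
    have hlin : ∀ t : ℝ, HasDerivAt (fun t : ℝ => (t:ℂ) * l) l t := fun t => by
      simpa using (Complex.ofRealCLM.hasDerivAt (x := t)).mul_const l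
    have := aux_path2 τ h1 htr hpos hstar (fun t => F ((t:ℂ) * l)) (fun t => l • F1 ((t:ℂ) * l))
      (fun t ht => (dF _).scomp t (hlin t)) (fun t ht => hu _ (hseg t ht)) (by simp [eF])
      ρ m hρ hρm (fun t ht => hm _ (hseg t ht)) (fun t => (g ((t:ℂ) * l)).re) (by simp [hg0])
      (fun t ht => by
        have := Complex.reCLM.hasFDerivAt.comp_hasDerivAt t ((hg _ (hseg t ht)).scomp t (hlin t))
        refine this.congr_deriv ?_
        simp [hh, hI])
    simpa using this
  have hgd : DifferentiableOn ℂ g (Metric.ball 0 R) := fun l hl =>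
    (hg l hl).differentiableAt.differentiableWithinAt
  have hcl : Metric.closedBall (0:ℂ) (R/2) ⊆ Metric.ball 0 R :=
    Metric.closedBall_subset_ball (by linarith)
  have hb : ∀ z ∈ Metric.sphere (0:ℂ) (R/2), ‖g z‖ ≤ 2 * Real.log m := by
    intro z hz
    have := Complex.borelCaratheodory_zero hlog hgd hre hR (hcl (Metric.sphere_subset_closedBall hz))
      hg0
    rw [mem_sphere_zero_iff_norm.mp hz] at this
    refine this.trans (le_of_eq ?_)
    field_simp
    ring
  have hC := Complex.norm_iteratedDeriv_le_of_forall_mem_sphere_norm_le 3 (by linarith : 0 < R/2)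
    ((hgd.mono (by rw [closure_ball _ (by linarith)]; exact hcl)).diffContOnCl) hb
  have hn : Metric.ball (0:ℂ) R ∈ nhds (0:ℂ) := Metric.ball_mem_nhds _ hR
  have e3 : iteratedDeriv 3 g 0 = 2 * τ (3 • c 3 - 3 • (c 1 * c 2) + c 1 * c 1 * c 1) := by
    rw [iteratedDeriv_succ, iteratedDeriv_succ, iteratedDeriv_one]
    have q1 : Set.EqOn (deriv g) h (Metric.ball 0 R) := fun l hl => (hg l hl).deriv
    have q2 : Set.EqOn (deriv (deriv g))
        (fun l => τ (-(I l * F1 l * I l) * F1 l + I l * F2 l)) (Metric.ball 0 R) := by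
      intro l hl
      rw [(q1.eventuallyEq_of_mem (Metric.isOpen_ball.mem_nhds hl)).deriv_eq]
      exact (dh l hl).deriv
    rw [(q2.eventuallyEq_of_mem hn).deriv_eq]
    have dI0 := dI 0 hmem0
    have d := τ.hasFDerivAt.comp_hasDerivAt 0
      ((((dI0.mul (dF1 0)).mul dI0).neg.mul (dF1 0)).add (dI0.mul (dF2 0)))
    refine d.deriv.trans ?_
    have t3 : ∀ x : A, τ (3 * x) = 3 * τ x := by
      intro x
      rw [show (3:A) * x = x + x + x by noncomm_ring]
      simp only [map_add]
      ring
    simp [eI, eF1, eF2, eF3, add_mul, t3, htr (c 2) (c 1)]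
    ring
  rw [e3, norm_mul] at hC
  generalize τ (3 • c 3 - 3 • (c 1 * c 2) + c 1 * c 1 * c 1) = w at hC ⊢
  norm_num [Nat.factorial] at hC
  rw [div_pow] at hC
  field_simp at hC ⊢
  linarith

theorem aux_norm_pow {B : Type*} [NormedRing B] (a : B) (k : ℕ) :
    ‖a ^ k‖ ≤ (1 + ‖(1:B)‖) * ‖a‖ ^ k := by
  rcases k with _ | k
  · simp
  · have := norm_pow_le' a (Nat.succ_pos k)
    have h2 := mul_nonneg (norm_nonneg (1:B)) (pow_nonneg (norm_nonneg a) (k+1))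
    simp only [Nat.succ_eq_add_one] at this
    linarith

noncomputable def auxE {B : Type*} [NormedRing B] [NormedAlgebra ℂ B] (a : B) (k : ℕ) : B :=
  ((k.factorial : ℂ)⁻¹) • a ^ k

noncomputable def auxd {B : Type*} [NormedRing B] [NormedAlgebra ℂ B] (a b : B) (k : ℕ) : B :=
  ∑ p ∈ Finset.HasAntidiagonal.antidiagonal k, auxE a p.1 * auxE b p.2

noncomputable def auxp (J r : ℝ) (k : ℕ) : ℝ := J * (r ^ k / k.factorial)

theorem auxE_norm {B : Type*} [NormedRing B] [NormedAlgebra ℂ B] (a : B) (k : ℕ) (l : ℂ) (R : ℝ)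
    (hl : ‖l‖ ≤ R) : ‖l ^ k • auxE a k‖ ≤ auxp (1 + ‖(1:B)‖) (R * ‖a‖) k := by
  rw [auxE, auxp, norm_smul, norm_smul, norm_pow, norm_inv, Complex.norm_natCast, mul_pow]
  have h1 := aux_norm_pow a k
  have h2 : ‖l‖ ^ k ≤ R ^ k := pow_le_pow_left₀ (norm_nonneg l) hl k
  calc ‖l‖ ^ k * ((k.factorial:ℝ)⁻¹ * ‖a ^ k‖)
      ≤ R ^ k * ((k.factorial:ℝ)⁻¹ * ((1 + ‖(1:B)‖) * ‖a‖ ^ k)) := by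
        have : 0 ≤ R := (norm_nonneg l).trans hl
        gcongr
    _ = _ := by ring

theorem auxp_hasSum (J r : ℝ) : HasSum (auxp J r) (J * Real.exp r) := by
  have := NormedSpace.expSeries_div_hasSum_exp (𝔸 := ℝ) r
  rw [← Real.exp_eq_exp_ℝ] at this
  exact this.mul_left J

theorem aux_exp_hasSum {B : Type*} [NormedRing B] [NormedAlgebra ℂ B] [CompleteSpace B]
    (a : B) (l : ℂ) : ∃ u : Bˣ, HasSum (fun k => l ^ k • auxE a k) (u : B) ∧
      ‖(↑u⁻¹ : B)‖ ≤ (1 + ‖(1:B)‖) * Real.exp (‖l‖ * ‖a‖) := by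
  let _ : NormedAlgebra ℚ B := NormedAlgebra.restrictScalars ℚ ℂ B
  have hs : ∀ l : ℂ, HasSum (fun k => l ^ k • auxE a k) (NormedSpace.exp (l • a)) := by
    intro l
    have := NormedSpace.exp_series_hasSum_exp' (𝕂 := ℂ) (l • a)
    convert this using 2 with k
    rw [auxE, smul_pow, smul_comm]
  have hc : Commute (l • a) ((-l) • a) := ((Commute.refl a).smul_left l).smul_right (-l)
  have h1 : NormedSpace.exp (l • a) * NormedSpace.exp ((-l) • a) = 1 := by
    rw [← NormedSpace.exp_add_of_commute hc, ← add_smul]; simp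
  have h2 : NormedSpace.exp ((-l) • a) * NormedSpace.exp (l • a) = 1 := by
    rw [← NormedSpace.exp_add_of_commute hc.symm, ← add_smul]; simp
  refine ⟨⟨_, _, h1, h2⟩, hs l, ?_⟩
  have := tsum_of_norm_bounded (auxp_hasSum (1 + ‖(1:B)‖) (‖l‖ * ‖a‖))
    (fun k => auxE_norm a k (-l) ‖l‖ (by simp))
  rwa [(hs (-l)).tsum_eq] at this

theorem aux_trunc {B : Type*} [NormedRing B] [NormedAlgebra ℂ B] [CompleteSpace B]
    (a b : B) (R : ℝ) (hR : 0 < R) : ∃ N : ℕ, ∀ l : ℂ, ‖l‖ ≤ R →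
      IsUnit (∑ k ∈ Finset.range (N + 4), l ^ k • auxd a b k) ∧
      ‖∑ k ∈ Finset.range (N + 4), l ^ k • auxd a b k‖ ≤
        (1 + ‖(1:B)‖) ^ 2 * Real.exp (R * (‖a‖ + ‖b‖)) := by
  set J := 1 + ‖(1:B)‖ with hJ
  have hJ1 : 1 ≤ J := by rw [hJ]; linarith [norm_nonneg (1:B)]
  set p := auxp J (R * ‖a‖) with hp
  set q := auxp J (R * ‖b‖) with hq
  have hp0 : ∀ k, 0 ≤ p k := fun k => by simp only [hp, auxp]; positivity
  have hq0 : ∀ k, 0 ≤ q k := fun k => by simp only [hq, auxp]; positivity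
  have hps := auxp_hasSum J (R * ‖a‖)
  have hqs := auxp_hasSum J (R * ‖b‖)
  set s : ℕ → ℝ := fun k => ∑ x ∈ Finset.HasAntidiagonal.antidiagonal k, p x.1 * q x.2 with hs
  have hs0 : ∀ k, 0 ≤ s k := fun k => Finset.sum_nonneg fun x _ => mul_nonneg (hp0 _) (hq0 _)
  have hpn : Summable (fun k => ‖p k‖) := by simpa using hps.summable.norm
  have hqn : Summable (fun k => ‖q k‖) := by simpa using hqs.summable.norm
  have hss : Summable s := (summable_norm_sum_mul_antidiagonal_of_summable_norm hpn hqn).of_norm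
  set M := J ^ 2 * Real.exp (R * (‖a‖ + ‖b‖)) with hM
  have hst : ∑' k, s k = M := by
    rw [hs, ← tsum_mul_tsum_eq_tsum_sum_antidiagonal_of_summable_norm hpn hqn, hps.tsum_eq,
      hqs.tsum_eq, hM, mul_add, Real.exp_add]
    ring
  have hM0 : 0 < M := by positivity
  have hd : ∀ l : ℂ, ∀ k, l ^ k • auxd a b k =
      ∑ x ∈ Finset.HasAntidiagonal.antidiagonal k, (l ^ x.1 • auxE a x.1) * (l ^ x.2 • auxE b x.2) := by
    intro l k
    rw [auxd, Finset.smul_sum]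
    refine Finset.sum_congr rfl fun x hx => ?_
    rw [smul_mul_smul_comm, ← pow_add, Finset.HasAntidiagonal.mem_antidiagonal.mp hx]
  have hdn : ∀ l : ℂ, ‖l‖ ≤ R → ∀ k, ‖l ^ k • auxd a b k‖ ≤ s k := by
    intro l hl k
    rw [hd]
    refine (norm_sum_le _ _).trans (Finset.sum_le_sum fun x _ => ?_)
    exact (norm_mul_le _ _).trans (mul_le_mul (auxE_norm a _ l R hl) (auxE_norm b _ l R hl)
      (norm_nonneg _) (hp0 _))
  have htail : Filter.Tendsto (fun N => M * ∑' k, s (k + N)) Filter.atTop (nhds 0) := by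
    simpa using (tendsto_sum_nat_add s).const_mul M
  obtain ⟨N, hN⟩ := ((htail.comp (Filter.tendsto_add_atTop_nat 4)).eventually_lt_const
    (zero_lt_one)).exists
  refine ⟨N, fun l hl => ⟨?_, ?_⟩⟩
  · obtain ⟨u, hu, hun⟩ := aux_exp_hasSum a l
    obtain ⟨v, hv, hvn⟩ := aux_exp_hasSum b l
    have hun1 : Summable fun k => ‖l ^ k • auxE a k‖ :=
      Summable.of_nonneg_of_le (fun _ => norm_nonneg _) (fun k => auxE_norm a k l R hl) hps.summable
    have hvn1 : Summable fun k => ‖l ^ k • auxE b k‖ :=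
      Summable.of_nonneg_of_le (fun _ => norm_nonneg _) (fun k => auxE_norm b k l R hl) hqs.summable
    have hprod : ∑' k, l ^ k • auxd a b k = (u : B) * v := by
      rw [← hu.tsum_eq, ← hv.tsum_eq,
        tsum_mul_tsum_eq_tsum_sum_antidiagonal_of_summable_norm hun1 hvn1]
      exact tsum_congr fun k => hd l k
    have hds : Summable fun k => l ^ k • auxd a b k :=
      Summable.of_norm_bounded hss (hdn l hl)
    have hsplit := hds.sum_add_tsum_nat_add (N + 4)
    rw [hprod] at hsplit
    set x := ∑ k ∈ Finset.range (N + 4), l ^ k • auxd a b k with hx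
    set w := ∑' k, l ^ (k + (N + 4)) • auxd a b (k + (N + 4)) with hw
    have hwn : ‖w‖ ≤ ∑' k, s (k + (N+4)) :=
      tsum_of_norm_bounded ((summable_nat_add_iff (N+4)).mpr hss).hasSum
        (fun k => hdn l hl (k + (N+4)))
    have hinv : ‖(↑(u * v)⁻¹ : B)‖ ≤ M := by
      rw [mul_inv_rev, Units.val_mul]
      have hea : Real.exp (‖l‖ * ‖a‖) ≤ Real.exp (R * ‖a‖) := by gcongr
      have heb : Real.exp (‖l‖ * ‖b‖) ≤ Real.exp (R * ‖b‖) := by gcongr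
      calc ‖(↑v⁻¹ : B) * ↑u⁻¹‖ ≤ ‖(↑v⁻¹ : B)‖ * ‖(↑u⁻¹ : B)‖ := norm_mul_le _ _
        _ ≤ (J * Real.exp (R * ‖b‖)) * (J * Real.exp (R * ‖a‖)) := by
          refine mul_le_mul (hvn.trans ?_) (hun.trans ?_) (norm_nonneg _) (by positivity) <;> gcongr
        _ = M := by rw [hM, mul_add, Real.exp_add]; ring
    have hlt : ‖(↑(u * v)⁻¹ : B) * w‖ < 1 := by
      refine lt_of_le_of_lt ?_ hN
      refine (norm_mul_le _ _).trans ?_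
      exact mul_le_mul hinv hwn (norm_nonneg _) hM0.le
    have hxe : x = ↑(u * v) * (1 - (↑(u * v)⁻¹ : B) * w) := by
      rw [mul_sub, mul_one, Units.mul_inv_cancel_left, Units.val_mul, ← hsplit]
      abel
    rw [hxe]
    exact (u * v).isUnit.mul (isUnit_one_sub_of_norm_lt_one hlt)
  · refine (norm_sum_le _ _).trans ((Finset.sum_le_sum fun k _ => hdn l hl k).trans ?_)
    rw [← hst]
    exact hss.sum_le_tsum _ fun k _ => hs0 k

theorem aux_cubic {B A : Type*} [NormedRing B] [NormedAlgebra ℂ B] [CompleteSpace B]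
    [CStarAlgebra A] [Nontrivial A] (τ : A →L[ℂ] ℂ)
    (h1 : τ 1 = 1)
    (htr : ∀ a b : A, τ (a * b) = τ (b * a))
    (hpos : ∀ a : A, 0 ≤ τ (star a * a))
    (hstar : ∀ a, τ (star a) = star (τ a))
    (T : B →ₗ[ℂ] A) (hT1 : T 1 = 1)
    (hTinv : ∀ x : B, IsUnit x → IsUnit (T x)) (a b : B) :
    τ (3 • T (auxd a b 3) - 3 • (T (auxd a b 1) * T (auxd a b 2)) +
      T (auxd a b 1) * T (auxd a b 1) * T (auxd a b 1)) = 0 := by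
  set w := τ (3 • T (auxd a b 3) - 3 • (T (auxd a b 1) * T (auxd a b 2)) +
      T (auxd a b 1) * T (auxd a b 1) * T (auxd a b 1)) with hw
  set J := 1 + ‖(1:B)‖ with hJ
  have hJ1 : 1 ≤ J := by rw [hJ]; linarith [norm_nonneg (1:B)]
  have hJ0 : 0 < J := by linarith
  set S := ‖a‖ + ‖b‖ with hS
  have hS0 : 0 ≤ S := by positivity
  have hspec : ∀ x : B, ∀ z ∈ spectrum ℂ (T x), ‖z‖ ≤ ‖x‖ * ‖(1:B)‖ := by
    intro x z hz
    refine spectrum.norm_le_norm_mul_of_mem (𝕜 := ℂ) ?_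
    rw [spectrum.mem_iff] at hz ⊢
    intro hx
    apply hz
    have := hTinv _ hx
    rwa [map_sub, Algebra.algebraMap_eq_smul_one, map_smul, hT1,
      ← Algebra.algebraMap_eq_smul_one] at this
  have key : ∀ R : ℝ, 0 < R → ‖w‖ ≤ 48 * (1 + 3 * Real.log J + R * S) / R ^ 3 := by
    intro R hR
    obtain ⟨N, hN⟩ := aux_trunc a b R hR
    have hTS : ∀ l : ℂ, auxS (fun k => T (auxd a b k)) (N+4) l =
        T (∑ k ∈ Finset.range (N + 4), l ^ k • auxd a b k) := by
      intro l
      simp [auxS, map_sum]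
    set ρ := J ^ 3 * Real.exp (R * S) with hρ
    have hρ1 : 1 ≤ ρ := by
      have : 1 ≤ Real.exp (R * S) := Real.one_le_exp (by positivity)
      exact one_le_mul_of_one_le_of_one_le (one_le_pow₀ hJ1) this
    have he : 1 < Real.exp 1 := Real.one_lt_exp_iff.mpr one_pos
    have hlog : Real.log (ρ * Real.exp 1) = 1 + 3 * Real.log J + R * S := by
      rw [Real.log_mul (by positivity) (by positivity), hρ,
        Real.log_mul (by positivity) (by positivity), Real.log_exp, Real.log_exp, Real.log_pow]
      push_cast; ring
    have := aux_coeff τ h1 htr hpos hstar (fun k => T (auxd a b k))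
      (by simp [auxd, auxE, hT1]) N R hR
      (fun l hl => by
        rw [hTS]
        exact hTinv _ (hN l (mem_ball_zero_iff.mp hl).le).1)
      ρ (ρ * Real.exp 1) (by linarith) (by nlinarith) (by nlinarith)
      (fun l hl z hz => by
        rw [hTS] at hz
        refine (hspec _ z hz).trans ?_
        have h2 := (hN l (mem_ball_zero_iff.mp hl).le).2
        have h3 : ‖(1:B)‖ ≤ J := by rw [hJ]; linarith
        calc _ ≤ (J ^ 2 * Real.exp (R * S)) * J :=
              mul_le_mul h2 h3 (norm_nonneg _) (by positivity)
          _ = ρ := by rw [hρ]; ring)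
    rw [hlog] at this
    exact this
  have hlim : Filter.Tendsto (fun R : ℝ => 48 * (1 + 3 * Real.log J + R * S) / R ^ 3)
      Filter.atTop (nhds 0) := by
    have hi := tendsto_inv_atTop_zero (𝕜 := ℝ)
    have h3 := ((hi.pow 3).const_mul (48 * (1 + 3 * Real.log J))).add ((hi.pow 2).const_mul (48 * S))
    simp only [ne_eq, OfNat.ofNat_ne_zero, not_false_eq_true, zero_pow, mul_zero, add_zero] at h3
    refine h3.congr' ?_
    filter_upwards [Filter.eventually_gt_atTop (0:ℝ)] with R hR
    field_simp
  have : ‖w‖ ≤ 0 := ge_of_tendsto hlim (by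
    filter_upwards [Filter.eventually_gt_atTop (0:ℝ)] with R hR using key R hR)
  exact norm_le_zero_iff.mp this

theorem auxd_one {B : Type*} [NormedRing B] [NormedAlgebra ℂ B] (a b : B) :
    auxd a b 1 = a + b := by
  simp [auxd, auxE, Finset.Nat.antidiagonal_succ, add_comm]

theorem auxd_two {B : Type*} [NormedRing B] [NormedAlgebra ℂ B] (a b : B) :
    auxd a b 2 = (1/2:ℂ) • (a * a) + a * b + (1/2:ℂ) • (b * b) := by
  simp [auxd, auxE, Finset.Nat.antidiagonal_succ, Nat.factorial, pow_succ]
  module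

theorem auxd_three {B : Type*} [NormedRing B] [NormedAlgebra ℂ B] (a b : B) :
    auxd a b 3 = (1/6:ℂ) • (a * a * a) + (1/2:ℂ) • (a * a * b) + (1/2:ℂ) • (a * (b * b))
      + (1/6:ℂ) • (b * b * b) := by
  simp [auxd, auxE, Finset.Nat.antidiagonal_succ, Nat.factorial, pow_succ]
  module


/-- For a surjective unital invertibility-preserving linear map `T` into a unital
C*-algebra with faithful tracial state `τ`, one has
`τ (T(a²b) + (Ta)² Tb + Tb (Ta)² - T(a²) Tb - 2 T(ab) Ta) = 0`. -/
theorem trace_second_order_identity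
    {B A : Type*} [NormedRing B] [NormedAlgebra ℂ B] [CompleteSpace B]
    [CStarAlgebra A]
    (τ : A →ₗ[ℂ] ℂ)
    (hτ1 : τ 1 = 1)
    (hτtrace : ∀ a b : A, τ (a * b) = τ (b * a))
    (hτpos : ∀ a : A, 0 ≤ τ (star a * a))
    (hτfaithful : ∀ a : A, τ (star a * a) = 0 → a = 0)
    (T : B →ₗ[ℂ] A)
    (hTsurj : Function.Surjective T)
    (hT1 : T 1 = 1)
    (hTinv : ∀ x : B, IsUnit x → IsUnit (T x)) :
    ∀ a b : B,
      τ (T (a * a * b) + T a * T a * T b + T b * (T a * T a)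
          - T (a * a) * T b - 2 • (T (a * b) * T a)) = 0 := by
  obtain ⟨⟨t, ht⟩, hstar⟩ := aux_tau_clm τ hτpos
  have hne : Nontrivial A := by
    refine ⟨⟨1, 0, fun h => ?_⟩⟩
    rw [h, map_zero] at hτ1
    exact zero_ne_one hτ1
  simp only [← ht] at hτ1 hτtrace hτpos hstar ⊢
  intro a b
  have hz : ∀ z : ℂ, _ := fun z =>
    aux_cubic t hτ1 hτtrace hτpos hstar T hT1 hTinv a (z • b)
  simp only [auxd_one, auxd_two, auxd_three] at hz
  have t3 : ∀ x : A, t (3 • x) = 3 * t x := by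
    intro x; rw [map_nsmul]; simp
  have t2 : ∀ x : A, t (2 • x) = 2 * t x := by
    intro x; rw [map_nsmul]; simp
  simp only [map_add, map_sub, map_smul, mul_add, add_mul, mul_smul_comm, smul_mul_assoc,
    smul_smul, smul_eq_mul, t3, t2] at hz ⊢
  have c1 : t (T a * T b * T a) = t (T a * T a * T b) := by
    rw [hτtrace, mul_assoc]
  have c2 : t (T b * T a * T a) = t (T a * T a * T b) := by
    rw [mul_assoc, hτtrace]
  have c3 : t (T b * (T a * T a)) = t (T a * T a * T b) := by
    rw [hτtrace]
  have c4 := hτtrace (T b) (T (a * a))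
  have c5 := hτtrace (T a) (T (a * b))
  have hp := hz 1
  have hm := hz (-1)
  have hp2 := hz 2
  have hm2 := hz (-2)
  rw [c1, c2, c4, c5] at hp hm hp2 hm2
  rw [c3]
  linear_combination (2/3/12 : ℂ) * (8 * (hp - hm) - (hp2 - hm2))
end

section
/- Let B be a unital complex Banach algebra, A a unital C*-algebra with a faithful tracial state τ, and T : B → A a surjective unital linear mapping which preserves invertible elements. Then τ((T a)² T b) = τ(T(a²) T b) for all a, b ∈ B. -/
open scoped ComplexOrder
section FK
variable {A : Type*} [CStarAlgebra A] 

theorem ispow_deriv (φ : A →L[ℂ] ℂ) (hφ : ∀ a b, φ (a * b) = φ (b * a))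
    (w : ℝ → A) (w' : A) (t : ℝ) (hw : HasDerivAt w w' t) (k : ℕ) :
    ∃ D, HasDerivAt (fun s => w s ^ (k+1)) D t ∧
      ∀ v, Commute v (w t) → φ (v * D) = (k+1) * φ (v * w t ^ k * w') := by
  induction k with
  | zero => exact ⟨w', by simpa using hw, by simp⟩
  | succ k ih =>
    obtain ⟨D, hD, h⟩ := ih
    refine ⟨D * w t + w t ^ (k+1) * w', ?_, ?_⟩
    · have := hD.mul hw
      convert this using 1
      ext s
      exact pow_succ _ _
    · intro v hv
      have h1 : φ (v * (D * w t)) = φ ((w t * v) * D) := by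
        rw [← mul_assoc, hφ, mul_assoc]
      have h2 : Commute (w t * v) (w t) := (Commute.refl _).mul_left hv
      rw [mul_add, map_add, h1, h _ h2, ← hv.eq, mul_assoc v (w t), ← pow_succ', ← mul_assoc]
      push_cast
      ring

theorem pos_unit_norm_lt [PartialOrder A] [StarOrderedRing A] (x : A) (hx : 0 ≤ x) (hu : IsUnit x) (c : ℝ) (hc : 0 < c)
    (hxc : ‖x‖ ≤ c) : 0 ≤ (1 - c⁻¹ • x : A) ∧ ‖(1 - c⁻¹ • x : A)‖ < 1 := by
  have h1 : x ≤ algebraMap ℝ A c := (CStarAlgebra.norm_le_iff_le_algebraMap x hc.le hx).1 hxc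
  have h2 : c⁻¹ • x ≤ 1 := by
    have := smul_le_smul_of_nonneg_left h1 (inv_nonneg.2 hc.le)
    rwa [Algebra.algebraMap_eq_smul_one, smul_smul, inv_mul_cancel₀ hc.ne', one_smul] at this
  have h3 : 0 ≤ (1 - c⁻¹ • x : A) := sub_nonneg.2 h2
  refine ⟨h3, ?_⟩
  nontriviality A
  have h4 : ‖(1 - c⁻¹ • x : A)‖ ≤ 1 := by
    rw [CStarAlgebra.norm_le_iff_le_algebraMap _ zero_le_one h3]
    simpa using smul_nonneg (inv_nonneg.2 hc.le) hx
  refine lt_of_le_of_ne h4 fun h5 => ?_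
  have h6 := CStarAlgebra.norm_mem_spectrum_of_nonneg h3
  rw [h5, spectrum.mem_iff] at h6
  apply h6
  simpa using (Units.mk0 _ (inv_ne_zero hc.ne')).isUnit.map (algebraMap ℝ A) |>.mul hu |> (by 
    simpa [Algebra.smul_def] using ·)

theorem pow_lower [PartialOrder A] [StarOrderedRing A] (w : A) (m : ℝ) (hm : 0 ≤ m) (hw : algebraMap ℝ A m ≤ w) (k : ℕ) :
    algebraMap ℝ A (m ^ k) ≤ w ^ k := by
  have h0 : (0 : A) ≤ w := (by simpa using (algebraMap_mono A hm) : (0:A) ≤ algebraMap ℝ A m).trans hw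
  have hs : IsSelfAdjoint w := .of_nonneg h0
  rw [algebraMap_le_iff_le_spectrum (hs.pow k)]
  rw [algebraMap_le_iff_le_spectrum hs] at hw
  rw [← cfc_pow_id (R := ℝ) w k, cfc_map_spectrum (R := ℝ) (fun x => x ^ k) w]
  rintro _ ⟨y, hy, rfl⟩
  exact pow_le_pow_left₀ hm (hw y hy) k

theorem trace_logderiv [PartialOrder A] [StarOrderedRing A] (φ : A →L[ℂ] ℂ)
    (hφ : ∀ a b, φ (a * b) = φ (b * a)) (hstar : ∀ a, φ (star a) = star (φ a))
    (g gi g' : A) (h1 : g * gi = 1) :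
    (φ ((gi * star gi) * (star g' * g + star g * g'))).re = 2 * (φ (gi * g')).re := by
  have e1 : φ ((gi * star gi) * (star g' * g)) = star (φ (gi * g')) := by
    rw [hφ gi g', ← hstar, ← mul_assoc, hφ, star_mul, ← mul_assoc, ← mul_assoc, h1, one_mul]
  have e2 : (gi * star gi) * (star g * g') = gi * g' := by
    rw [mul_assoc, ← mul_assoc (star gi), ← star_mul, h1, star_one, one_mul]
  rw [mul_add, map_add, e1, e2]
  simp
  ring

open Set Filter Topology in
theorem fk_bound [PartialOrder A] [StarOrderedRing A] (φ : A →L[ℂ] ℂ)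
    (hφ : ∀ a b, φ (a * b) = φ (b * a)) (hφ1 : φ 1 = 1) (hpos : ∀ a, 0 ≤ a → 0 ≤ φ a)
    (hstar : ∀ a, φ (star a) = star (φ a))
    (γ : ℝ → A) (hγ : ContDiff ℝ 1 γ) (hu : ∀ t ∈ Icc (0:ℝ) 1, IsUnit (γ t)) (h0 : γ 0 = 1)
    (L : ℝ → ℝ)
    (hL : ∀ t ∈ Icc (0:ℝ) 1, HasDerivAt L (φ (Ring.inverse (γ t) * deriv γ t)).re t) :
    L 1 - L 0 ≤ Real.log ‖γ 1‖ := by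
  have hnt : Nontrivial A := by
    by_contra h
    rw [not_nontrivial_iff_subsingleton] at h
    have : (1 : A) = 0 := Subsingleton.elim _ _
    rw [this, map_zero] at hφ1
    exact zero_ne_one hφ1
  have hγd : ∀ t, HasDerivAt γ (deriv γ t) t := fun t =>
    (hγ.differentiable one_ne_zero t).hasDerivAt
  have hγc : Continuous γ := hγ.continuous
  have hγ'c : Continuous (deriv γ) := hγ.continuous_deriv le_rfl
  set x : ℝ → A := fun t => star (γ t) * γ t with hx
  set x' : ℝ → A := fun t => star (deriv γ t) * γ t + star (γ t) * deriv γ t with hx'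
  have hxc : Continuous x := by fun_prop
  have hx'c : Continuous x' := by fun_prop
  have hxd : ∀ t, HasDerivAt x (x' t) t := fun t => (hγd t).star.mul (hγd t)
  have hxpos : ∀ t, 0 ≤ x t := fun t => star_mul_self_nonneg _
  have hxu : ∀ t ∈ Icc (0:ℝ) 1, IsUnit (x t) := fun t ht => (hu t ht).star.mul (hu t ht)
  have hx0 : x 0 = 1 := by simp [hx, h0]
  obtain ⟨c, hc⟩ := isCompact_Icc.exists_bound_of_continuousOn (s := Icc (0:ℝ) 1) hxc.continuousOn
  have h0m : (0:ℝ) ∈ Icc (0:ℝ) 1 := by simp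
  have h1m : (1:ℝ) ∈ Icc (0:ℝ) 1 := by simp
  have hc1 : 1 ≤ c := by simpa [hx0] using hc 0 h0m
  have hc0 : 0 < c := by linarith
  set w : ℝ → A := fun t => 1 - c⁻¹ • x t with hw
  have hwc : Continuous w := by fun_prop
  have hwp : ∀ t ∈ Icc (0:ℝ) 1, 0 ≤ w t ∧ ‖w t‖ < 1 := fun t ht =>
    pos_unit_norm_lt (x t) (hxpos t) (hxu t ht) c hc0 (hc t ht)
  have hwd : ∀ t, HasDerivAt w (-(c⁻¹ • x' t)) t := fun t => by
    simpa using ((hxd t).const_smul c⁻¹).const_sub 1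
  obtain ⟨t0, ht0, hq⟩ := isCompact_Icc.exists_isMaxOn (s := Icc (0:ℝ) 1) ⟨0, h0m⟩
    hwc.norm.continuousOn
  set q := ‖w t0‖
  have hq1 : q < 1 := (hwp t0 ht0).2
  have hq0 : 0 ≤ q := norm_nonneg _
  set y : ℝ → A := fun t => Ring.inverse (γ t) * star (Ring.inverse (γ t)) with hy
  have hyc : ContinuousOn y (Icc 0 1) := by
    have : ContinuousOn (fun t => Ring.inverse (γ t)) (Icc 0 1) := fun t ht => by
      obtain ⟨u, hu'⟩ := hu t ht
      have := NormedRing.inverse_continuousAt u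
      rw [hu'] at this
      exact (ContinuousAt.comp (f := γ) this hγc.continuousAt).continuousWithinAt
    exact this.mul this.star
  have hxy : ∀ t ∈ Icc (0:ℝ) 1, x t * y t = 1 := fun t ht => by
    have e : γ t * Ring.inverse (γ t) = 1 := Ring.mul_inverse_cancel _ (hu t ht)
    have e2 : Ring.inverse (γ t) * γ t = 1 := Ring.inverse_mul_cancel _ (hu t ht)
    simp only [hx, hy]
    rw [mul_assoc, ← mul_assoc (γ t), e, one_mul, ← star_mul, e2, star_one]
  obtain ⟨C, hC⟩ := isCompact_Icc.exists_bound_of_continuousOn (s := Icc (0:ℝ) 1)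
    (hyc.mul hx'c.continuousOn)
  have hC0 : 0 ≤ C := (norm_nonneg _).trans (hC 0 h0m)
  set F : ℕ → ℝ → ℝ := fun N t => ∑ k ∈ Finset.range N, (φ (w t ^ (k+1))).re / (k+1) with hF
  have hFd : ∀ N, ∀ t ∈ Icc (0:ℝ) 1, HasDerivAt (fun t => F N t + 2 * L t)
      ((φ (w t ^ N * (y t * x' t))).re) t := by
    intro N t ht
    have h1 : ∀ k : ℕ, HasDerivAt (fun t => (φ (w t ^ (k+1))).re / (k+1))
        (φ (w t ^ k * -(c⁻¹ • x' t))).re t := by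
      intro k
      obtain ⟨D, hD, hD2⟩ := ispow_deriv φ hφ w _ t (hwd t) k
      have e := hD2 1 (Commute.one_left _)
      simp only [one_mul] at e
      have h2 : HasDerivAt (fun s => (φ (w s ^ (k+1)))) (φ D) t :=
        (φ.restrictScalars ℝ).hasFDerivAt.comp_hasDerivAt t hD
      have h3 : HasDerivAt (fun s => (φ (w s ^ (k+1))).re) (φ D).re t :=
        Complex.reCLM.hasFDerivAt.comp_hasDerivAt t h2
      refine (h3.div_const ((k:ℝ)+1)).congr_deriv ?_
      rw [e]
      have : ((k:ℂ)+1) = (((k:ℝ)+1 : ℝ) : ℂ) := by push_cast; rfl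
      rw [this, Complex.re_ofReal_mul, mul_div_cancel_left₀]
      positivity
    have h2 : HasDerivAt (F N) (∑ k ∈ Finset.range N, (φ (w t ^ k * -(c⁻¹ • x' t))).re) t :=
      HasDerivAt.fun_sum fun k _ => h1 k
    have h3 := h2.add ((hL t ht).const_mul 2)
    refine h3.congr_deriv ?_
    have e0 := trace_logderiv φ hφ hstar (γ t) (Ring.inverse (γ t)) (deriv γ t)
      (Ring.mul_inverse_cancel _ (hu t ht))
    rw [← e0, ← Complex.re_sum, ← map_sum, ← Finset.sum_mul, ← Complex.add_re, ← map_add]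
    refine congrArg Complex.re (congrArg φ ?_)
    have e1 : (∑ k ∈ Finset.range N, w t ^ k) * (c⁻¹ • x t) = 1 - w t ^ N := by
      have := geom_sum_mul_neg (w t) N
      rwa [show 1 - w t = c⁻¹ • x t by simp [hw]] at this
    have e2 : c⁻¹ • (∑ k ∈ Finset.range N, w t ^ k) = y t - w t ^ N * y t := by
      have := congrArg (· * y t) e1
      simp only [mul_assoc, sub_mul, one_mul, smul_mul_assoc, hxy t ht, mul_smul_comm, mul_one] at this
      exact this
    change _ + y t * x' t = _
    rw [mul_neg, mul_smul_comm, ← smul_mul_assoc, e2]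
    noncomm_ring
  have hmv : ∀ N, F N 0 + 2 * L 0 - (F N 1 + 2 * L 1) ≥ -(‖φ‖ * (q ^ N * C)) := by
    intro N
    have := (convex_Icc (0:ℝ) 1).norm_image_sub_le_of_norm_hasDerivWithin_le
      (fun t ht => (hFd N t ht).hasDerivWithinAt) (C := ‖φ‖ * (q ^ N * C)) (fun t ht => by
        refine (Complex.abs_re_le_norm _).trans ((φ.le_opNorm _).trans ?_)
        gcongr
        refine (norm_mul_le _ _).trans ?_
        gcongr
        · refine (norm_pow_le _ _).trans ?_
          gcongr
          exact hq ht
        · exact hC t ht) h0m h1m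
    simp only [sub_zero, norm_one, mul_one, Real.norm_eq_abs] at this
    linarith [(abs_le.1 this).2]
  set M := ‖x 1‖ with hM
  have hM0 : 0 < M := norm_pos_iff.2 (hxu 1 h1m).ne_zero
  have hMc : M ≤ c := hc 1 h1m
  have hm1 : M / c ≤ 1 := (div_le_one hc0).2 hMc
  have hmp : 0 < M / c := by positivity
  have hF1 : ∀ N, ∑ k ∈ Finset.range N, (1 - M / c) ^ (k+1) / ((k:ℝ)+1) ≤ F N 1 := by
    intro N
    apply Finset.sum_le_sum
    intro k _
    gcongr
    have h1 : algebraMap ℝ A (1 - M / c) ≤ w 1 := by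
      have h1 : x 1 ≤ algebraMap ℝ A M :=
        (CStarAlgebra.norm_le_iff_le_algebraMap _ hM0.le (hxpos 1)).1 le_rfl
      have := smul_le_smul_of_nonneg_left h1 (inv_nonneg.2 hc0.le)
      rw [map_sub, map_one]
      apply sub_le_sub_left
      rwa [Algebra.algebraMap_eq_smul_one, smul_smul, mul_comm, ← div_eq_mul_inv,
        ← Algebra.algebraMap_eq_smul_one] at this
    have h2 := hpos _ (sub_nonneg.2 (pow_lower (w 1) _ (by linarith) h1 (k+1)))
    have h3 : φ (algebraMap ℝ A ((1 - M / c) ^ (k+1))) = (((1 - M / c) ^ (k+1) : ℝ) : ℂ) := by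
      rw [IsScalarTower.algebraMap_apply ℝ ℂ A, Algebra.algebraMap_eq_smul_one, map_smul, hφ1]
      simp
    rw [map_sub, h3] at h2
    have := (Complex.le_def.1 h2).1
    rw [Complex.sub_re, Complex.ofReal_re, Complex.zero_re] at this
    linarith
  have hF0 : ∀ N, F N 0 = ∑ k ∈ Finset.range N, (1 - 1 / c) ^ (k+1) / ((k:ℝ)+1) := by
    intro N
    apply Finset.sum_congr rfl
    intro k _
    congr 1
    have : w 0 = ((1 - 1 / c : ℝ) : ℂ) • (1 : A) := by
      simp only [hw, hx0]
      rw [Complex.coe_smul, sub_smul, one_smul, one_div]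
    rw [this, smul_pow, one_pow, map_smul, hφ1, smul_eq_mul, mul_one, ← Complex.ofReal_pow,
      Complex.ofReal_re]
  have hic : 0 < 1 / c := by positivity
  have hic1 : 1 / c ≤ 1 := (div_le_one hc0).2 hc1
  have s1 := (Real.hasSum_pow_div_log_of_abs_lt_one (x := 1 - M / c)
    (by rw [abs_lt]; constructor <;> linarith)).tendsto_sum_nat
  have s0 := (Real.hasSum_pow_div_log_of_abs_lt_one (x := 1 - 1 / c)
    (by rw [abs_lt]; constructor <;> linarith)).tendsto_sum_nat
  have s2 : Tendsto (fun N : ℕ => ‖φ‖ * (q ^ N * C)) atTop (𝓝 0) := by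
    simpa using ((tendsto_pow_atTop_nhds_zero_of_lt_one hq0 hq1).mul_const C).const_mul ‖φ‖
  have s3 := le_of_tendsto_of_tendsto' (a₁ := 2 * L 1 - 2 * L 0)
    tendsto_const_nhds ((s0.sub s1).add s2) (fun N => by
      have := hmv N
      have := hF1 N
      have := hF0 N
      linarith)
  rw [sub_sub_cancel, sub_sub_cancel, Real.log_div one_ne_zero hc0.ne',
    Real.log_div hM0.ne' hc0.ne', Real.log_one] at s3
  have hMM : M = ‖γ 1‖ * ‖γ 1‖ := CStarRing.norm_star_mul_self
  have hg : ‖γ 1‖ ≠ 0 := norm_ne_zero_iff.2 (hu 1 h1m).ne_zero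
  rw [hMM, Real.log_mul hg hg] at s3
  linarith

open Set Filter Topology in
theorem re_le_of_spectralRadius [PartialOrder A] [StarOrderedRing A] (φ : A →L[ℂ] ℂ)
    (hφ : ∀ a b, φ (a * b) = φ (b * a)) (hφ1 : φ 1 = 1) (hpos : ∀ a, 0 ≤ a → 0 ≤ φ a)
    (hstar : ∀ a, φ (star a) = star (φ a))
    (G : ℂ → A) (hG : ContDiff ℂ 1 G) (R : ℝ) 
    (hu : ∀ z ∈ Metric.ball (0:ℂ) R, IsUnit (G z)) (h0 : G 0 = 1)
    (h : ℂ → ℂ) (h00 : h 0 = 0)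
    (hh : ∀ z ∈ Metric.ball (0:ℂ) R, HasDerivAt h (φ (Ring.inverse (G z) * deriv G z)) z)
    (z : ℂ) (hz : z ∈ Metric.ball (0:ℂ) R) (M : ℝ)
    (hM : spectralRadius ℂ (G z) ≤ ENNReal.ofReal (Real.exp M)) : (h z).re ≤ M := by
  have hball : ∀ t ∈ Icc (0:ℝ) 1, (t:ℂ) * z ∈ Metric.ball (0:ℂ) R := by
    intro t ht
    rw [mem_ball_zero_iff] at hz ⊢
    rw [norm_mul, Complex.norm_real, Real.norm_eq_abs, abs_of_nonneg ht.1]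
    exact (mul_le_of_le_one_left (norm_nonneg _) ht.2).trans_lt hz
  have hlin : ∀ t : ℝ, HasDerivAt (fun t : ℝ => (t:ℂ) * z) z t := fun t => by
    simpa using (Complex.ofRealCLM.hasDerivAt (x := t)).mul_const z
  have key : ∀ k : ℕ, ((k:ℝ)+1) * (h z).re ≤ Real.log ‖G z ^ (k+1)‖ := by
    intro k
    have hc : ContDiff ℝ 1 (fun t : ℝ => G ((t:ℂ) * z)) :=
      (hG.restrict_scalars ℝ).comp (Complex.ofRealCLM.contDiff.mul contDiff_const)
    have := fk_bound φ hφ hφ1 hpos hstar (fun t : ℝ => G ((t:ℂ) * z) ^ (k+1)) (hc.pow _)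
      (fun t ht => (hu _ (hball t ht)).pow _) (by simp [h0])
      (fun t => ((k:ℝ)+1) * (h ((t:ℂ) * z)).re) (fun t ht => by
        have hd : HasDerivAt (fun t : ℝ => G ((t:ℂ) * z)) (z • deriv G (t * z)) t :=
          HasDerivAt.scomp t ((hG.differentiable one_ne_zero _).hasDerivAt) (hlin t)
        have hd2 : HasDerivAt (fun t : ℝ => h ((t:ℂ) * z)) _ t :=
          HasDerivAt.scomp t (hh _ (hball t ht)) (hlin t)
        have hd3 : HasDerivAt (fun t : ℝ => (h ((t:ℂ) * z)).re) _ t :=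
          Complex.reCLM.hasFDerivAt.comp_hasDerivAt t hd2
        refine (hd3.const_mul ((k:ℝ)+1)).congr_deriv ?_
        obtain ⟨D, hD, hD2⟩ := ispow_deriv φ hφ _ _ t hd k
        rw [hD.deriv]
        have hun := hu _ (hball t ht)
        have hcm : Commute (Ring.inverse (G (t * z) ^ (k+1))) (G (t*z)) := by
          rw [← Ring.inverse_pow]
          apply Commute.pow_left
          rw [Commute, SemiconjBy, Ring.mul_inverse_cancel _ hun, Ring.inverse_mul_cancel _ hun]
        rw [hD2 _ hcm]
        have e : Ring.inverse (G (t * z) ^ (k+1)) * G (t*z) ^ k = Ring.inverse (G (t*z)) := by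
          rw [← Ring.inverse_pow, pow_succ', mul_assoc, Ring.inverse_pow,
            Ring.inverse_mul_cancel _ (hun.pow k), mul_one]
        rw [e, mul_smul_comm, φ.map_smul]
        have : ((k:ℂ)+1) = (((k:ℝ)+1 : ℝ) : ℂ) := by push_cast; rfl
        rw [this, Complex.re_ofReal_mul]
        rfl)
    simpa [h00] using this
  have hlim := (tendsto_add_atTop_iff_nat 1).2
    (spectrum.pow_norm_pow_one_div_tendsto_nhds_spectralRadius (G z))
  have hle : ENNReal.ofReal (Real.exp (h z).re) ≤ spectralRadius ℂ (G z) := by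
    refine ge_of_tendsto' hlim fun k => ENNReal.ofReal_le_ofReal ?_
    have hnt : Nontrivial A := by
      by_contra h
      rw [not_nontrivial_iff_subsingleton] at h
      have : (1 : A) = 0 := Subsingleton.elim _ _
      rw [this, map_zero] at hφ1
      exact zero_ne_one hφ1
    have hp : 0 < ‖G z ^ (k+1)‖ := norm_pos_iff.2 ((hu z hz).pow _).ne_zero
    rw [Real.rpow_def_of_pos hp, Real.exp_le_exp]
    push_cast
    rw [mul_one_div, le_div_iff₀ (by positivity), mul_comm]
    exact key k
  have := hle.trans hM
  rwa [ENNReal.ofReal_le_ofReal_iff (Real.exp_pos _).le, Real.exp_le_exp] at this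

open Set Filter Topology in
theorem coeff_bounds [PartialOrder A] [StarOrderedRing A] (φ : A →L[ℂ] ℂ)
    (hφ : ∀ a b, φ (a * b) = φ (b * a)) (hφ1 : φ 1 = 1) (hpos : ∀ a, 0 ≤ a → 0 ≤ φ a)
    (hstar : ∀ a, φ (star a) = star (φ a))
    (G G1 G2 G3 : ℂ → A) (hG : ContDiff ℂ 1 G) (hG1 : ∀ z, HasDerivAt G (G1 z) z)
    (hG2 : ∀ z, HasDerivAt G1 (G2 z) z) (hG3 : ∀ z, HasDerivAt G2 (G3 z) z)
    (R : ℝ) (hR : 0 < R)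
    (hu : ∀ z ∈ Metric.ball (0:ℂ) R, IsUnit (G z)) (h0 : G 0 = 1)
    (M : ℝ) (hM0 : 0 < M)
    (hM : ∀ z ∈ Metric.ball (0:ℂ) R, spectralRadius ℂ (G z) ≤ ENNReal.ofReal (Real.exp M)) :
    ‖φ (G2 0) - φ (G1 0 * G1 0)‖ ≤ 16 * M / R ^ 2 ∧
    ‖φ (G3 0) - 3 * φ (G1 0 * G2 0) + 2 * φ (G1 0 * G1 0 * G1 0)‖ ≤ 96 * M / R ^ 3 := by
  set W : ℂ → A := fun z => Ring.inverse (G z) with hW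
  have hWd : ∀ z ∈ Metric.ball (0:ℂ) R, HasDerivAt W (-(W z * G1 z * W z)) z := by
    intro z hz
    obtain ⟨g, hg⟩ := hu z hz
    have h1 := hasFDerivAt_ringInverse (𝕜 := ℂ) g
    rw [hg] at h1
    refine (h1.comp_hasDerivAt z (hG1 z)).congr_deriv ?_
    simp [hW, ← hg]
  set u : ℂ → ℂ := fun z => φ (W z * G1 z) with hudef
  set u1 : ℂ → ℂ := fun z => φ (W z * G2 z - W z * G1 z * (W z * G1 z)) with hu1def
  have hud : ∀ z ∈ Metric.ball (0:ℂ) R, HasDerivAt u (u1 z) z := by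
    intro z hz
    refine (φ.hasFDerivAt.comp_hasDerivAt z ((hWd z hz).mul (hG2 z))).congr_deriv ?_
    simp only [hu1def]
    congr 1
    noncomm_ring
  have h0m : (0:ℂ) ∈ Metric.ball (0:ℂ) R := by simpa using hR
  have hW0 : W 0 = 1 := by simp [hW, h0]
  have hu2 : HasDerivAt u1 (φ (G3 0) - 3 * φ (G1 0 * G2 0) + 2 * φ (G1 0 * G1 0 * G1 0)) 0 := by
    have hWG := (hWd 0 h0m).mul (hG2 0)
    refine (φ.hasFDerivAt.comp_hasDerivAt 0
      (((hWd 0 h0m).mul (hG3 0)).sub (hWG.mul hWG))).congr_deriv ?_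
    simp only [hW0, Pi.mul_apply, one_mul, mul_one, map_sub, map_add, add_mul, mul_add, neg_mul, mul_neg,
      map_neg, hφ (G2 0) (G1 0), ← mul_assoc]
    ring
  have hex : Complex.IsExactOn u (Metric.ball (0:ℂ) R) :=
    DifferentiableOn.isExactOn_ball fun z hz => (hud z hz).differentiableAt.differentiableWithinAt
  obtain ⟨H, hH⟩ := hex
  set h : ℂ → ℂ := fun z => H z - H 0 with hdef
  have hh : ∀ z ∈ Metric.ball (0:ℂ) R, HasDerivAt h (u z) z := fun z hz => (hH z hz).sub_const _
  have hre : ∀ z ∈ Metric.ball (0:ℂ) R, (h z).re ≤ M := fun z hz =>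
    re_le_of_spectralRadius φ hφ hφ1 hpos hstar G hG R hu h0 h (by simp [hdef])
      (fun z hz => by rw [(hG1 z).deriv]; exact hh z hz) z hz M (hM z hz)
  have hdiff : DifferentiableOn ℂ h (Metric.ball 0 R) := fun z hz =>
    (hh z hz).differentiableAt.differentiableWithinAt
  have hsph : ∀ z ∈ Metric.sphere (0:ℂ) (R/2), ‖h z‖ ≤ 2 * M := by
    intro z hz
    rw [mem_sphere_zero_iff_norm] at hz
    have := Complex.borelCaratheodory_zero hM0 hdiff (fun z hz => hre z hz) hR
      (z := z) (by rw [mem_ball_zero_iff, hz]; linarith) (by simp [hdef])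
    rw [hz] at this
    convert this using 1
    field_simp
    ring
  have hdc : DiffContOnCl ℂ h (Metric.ball 0 (R/2)) := by
    apply DifferentiableOn.diffContOnCl
    apply hdiff.mono
    exact Metric.closure_ball_subset_closedBall.trans
      (Metric.closedBall_subset_ball (by linarith))
  have c2 := Complex.norm_iteratedDeriv_le_of_forall_mem_sphere_norm_le 2 (by linarith) hdc hsph
  have c3 := Complex.norm_iteratedDeriv_le_of_forall_mem_sphere_norm_le 3 (by linarith) hdc hsph
  have hn : Metric.ball (0:ℂ) R ∈ 𝓝 (0:ℂ) := Metric.isOpen_ball.mem_nhds h0m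
  have d1 : deriv h =ᶠ[𝓝 0] u := by
    filter_upwards [hn] with z hz using (hh z hz).deriv
  have d2 : deriv u =ᶠ[𝓝 0] u1 := by
    filter_upwards [hn] with z hz using (hud z hz).deriv
  have d2' : deriv (deriv h) =ᶠ[𝓝 0] u1 := d1.deriv.trans d2
  have i2 : iteratedDeriv 2 h 0 = φ (G2 0) - φ (G1 0 * G1 0) := by
    rw [iteratedDeriv_succ, iteratedDeriv_one, d2'.self_of_nhds]
    simp [hu1def, hW0]
  have i3 : iteratedDeriv 3 h 0 =
      φ (G3 0) - 3 * φ (G1 0 * G2 0) + 2 * φ (G1 0 * G1 0 * G1 0) := by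
    rw [iteratedDeriv_succ, iteratedDeriv_succ, iteratedDeriv_one, d2'.deriv_eq, hu2.deriv]
  rw [i2] at c2
  rw [i3] at c3
  refine ⟨c2.trans_eq ?_, c3.trans_eq ?_⟩
  · simp [Nat.factorial]; field_simp; ring
  · simp [Nat.factorial]; field_simp; ring

open Polynomial in
theorem coeff_one_add_pow {B : Type*} [Ring B] (a : B) (n k : ℕ) :
    ((1 + C a * X : B[X]) ^ n).coeff k = (n.choose k : B) * a ^ k := by
  have h1 : ∀ m : ℕ, (C a * X : B[X]) ^ m = C (a ^ m) * X ^ m := fun m => by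
    rw [(commute_X (C a)).symm.mul_pow, C_pow]
  rw [add_comm, (Commute.one_right _).add_pow, finsetSum_coeff]
  simp only [h1, one_pow, mul_one]
  have h2 : ∀ m : ℕ, (C (a ^ m) * X ^ m * (n.choose m : B[X])).coeff k
      = if m = k then (n.choose k : B) * a ^ k else 0 := by
    intro m
    rw [← C_eq_natCast, mul_assoc, X_pow_mul, ← mul_assoc, ← C_mul, coeff_C_mul_X_pow]
    split_ifs with h h' h'
    · rw [h, (Nat.cast_commute _ _).eq]
    · exact absurd h.symm h'
    · exact absurd h'.symm h
    · rfl
  simp only [h2]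
  rw [Finset.sum_ite_eq']
  split_ifs with h
  · rfl
  · rw [Finset.mem_range] at h
    rw [Nat.choose_eq_zero_of_lt (by omega)]
    simp

theorem polyfun_deriv (g : ℕ → A) (m : ℕ) : ∃ G1 G2 G3 : ℂ → A,
    ContDiff ℂ 1 (fun z : ℂ => ∑ k ∈ Finset.range (m+4), z ^ k • g k) ∧
    (∀ z, HasDerivAt (fun z : ℂ => ∑ k ∈ Finset.range (m+4), z ^ k • g k) (G1 z) z) ∧
    (∀ z, HasDerivAt G1 (G2 z) z) ∧ (∀ z, HasDerivAt G2 (G3 z) z) ∧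
    G1 0 = g 1 ∧ G2 0 = (2:ℂ) • g 2 ∧ G3 0 = (6:ℂ) • g 3 := by
  refine ⟨fun z => ∑ k ∈ Finset.range (m+4), ((k:ℂ) * z ^ (k-1)) • g k,
    fun z => ∑ k ∈ Finset.range (m+4), ((k:ℂ) * (((k-1 : ℕ):ℂ) * z ^ (k-1-1))) • g k,
    fun z => ∑ k ∈ Finset.range (m+4),
      ((k:ℂ) * (((k-1 : ℕ):ℂ) * (((k-1-1 : ℕ) : ℂ) * z ^ (k-1-1-1)))) • g k,
    ?_, ?_, ?_, ?_, ?_, ?_, ?_⟩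
  · fun_prop
  · intro z
    exact HasDerivAt.fun_sum fun k _ => (hasDerivAt_pow k z).smul_const _
  · intro z
    exact HasDerivAt.fun_sum fun k _ => ((hasDerivAt_pow _ z).const_mul _).smul_const _
  · intro z
    exact HasDerivAt.fun_sum fun k _ =>
      (((hasDerivAt_pow _ z).const_mul _).const_mul _).smul_const _
  · simp [Finset.sum_range_succ']
  · simp [Finset.sum_range_succ']
    norm_num
  · simp [Finset.sum_range_succ']
    norm_num

theorem norm_one_add_pow_mul_le {B : Type*} [NormedRing B] (x y : B) (hx : ‖x‖ ≤ 1) (n : ℕ) :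
    ‖(1 + x) ^ n * y‖ ≤ 2 ^ n * ‖y‖ := by
  induction n with
  | zero => simp
  | succ n ih =>
    rw [pow_succ', mul_assoc, add_mul, one_mul]
    have := norm_mul_le x ((1+x)^n * y)
    have h2 := mul_le_mul_of_nonneg_right hx (norm_nonneg ((1+x)^n * y))
    refine (norm_add_le _ _).trans ?_
    rw [pow_succ]
    linarith

open Set Filter Topology Polynomial in
theorem main_bound [PartialOrder A] [StarOrderedRing A] (φ : A →L[ℂ] ℂ)
    (hφ : ∀ a b, φ (a * b) = φ (b * a)) (hφ1 : φ 1 = 1) (hpos : ∀ a, 0 ≤ a → 0 ≤ φ a)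
    (hstar : ∀ a, φ (star a) = star (φ a))
    {B : Type*} [NormedRing B] [NormedAlgebra ℂ B] [CompleteSpace B]
    (T : B →ₗ[ℂ] A) (hT1 : T 1 = 1) (hTinv : ∀ x : B, IsUnit x → IsUnit (T x)) (a b : B) :
    ∃ E : ℝ, ∀ n : ℕ, 1 ≤ n → ∀ P : B[X],
      P = (1 + C ((n:ℂ)⁻¹ • a) * X) ^ n * (1 + C ((n:ℂ)⁻¹ • b) * X) ^ n →
      ‖2 * φ (T (P.coeff 2)) - φ (T (P.coeff 1) * T (P.coeff 1))‖ ≤ E / n ∧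
      ‖6 * φ (T (P.coeff 3)) - 6 * φ (T (P.coeff 1) * T (P.coeff 2))
        + 2 * φ (T (P.coeff 1) * T (P.coeff 1) * T (P.coeff 1))‖ ≤ E / n := by
  have hntA : Nontrivial A := by
    by_contra h
    rw [not_nontrivial_iff_subsingleton] at h
    have : (1 : A) = 0 := Subsingleton.elim _ _
    rw [this, map_zero] at hφ1
    exact zero_ne_one hφ1
  have hnt : Nontrivial B := by
    by_contra h
    rw [not_nontrivial_iff_subsingleton] at h
    have : (1 : B) = 0 := Subsingleton.elim _ _
    rw [this, map_zero] at hT1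
    exact zero_ne_one hT1
  set D := ‖a‖ + ‖b‖ + 1 with hD
  have hD1 : 1 ≤ D := by have := norm_nonneg a; have := norm_nonneg b; linarith
  have hone : 1 ≤ ‖(1:B)‖ := one_le_norm_one B
  set Q := 4 * ‖(1:B)‖ ^ 2 with hQ
  have hQ1 : 4 ≤ Q := by nlinarith
  set K := Real.log Q with hK
  have hK0 : 0 < K := Real.log_pos (by linarith)
  refine ⟨96 * K * D ^ 3, ?_⟩
  intro n hn P hP
  have hnr : (1:ℝ) ≤ n := by exact_mod_cast hn
  have hn0 : (0:ℝ) < n := by linarith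
  set f : ℂ → B := fun z => (1 + ((n:ℂ)⁻¹ * z) • a) ^ n * (1 + ((n:ℂ)⁻¹ * z) • b) ^ n with hf
  have hfP : ∀ z : ℂ, f z = ∑ k ∈ Finset.range (P.natDegree + 4), z ^ k • P.coeff k := by
    intro z
    have hcomm : ∀ x : B, Commute ((RingHom.id B) x) (algebraMap ℂ B z) := fun x =>
      (Algebra.commutes z x).symm
    have h1 : eval₂ (RingHom.id B) (algebraMap ℂ B z) P = f z := by
      change eval₂RingHom' (RingHom.id B) (algebraMap ℂ B z) hcomm P = f z
      have hl : ∀ c : B, eval₂RingHom' (RingHom.id B) (algebraMap ℂ B z) hcomm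
          (1 + C ((n:ℂ)⁻¹ • c) * X) = 1 + ((n:ℂ)⁻¹ * z) • c := by
        intro c
        rw [map_add, map_mul, map_one]
        simp only [eval₂RingHom', RingHom.coe_mk, MonoidHom.coe_mk, OneHom.coe_mk, eval₂_C, eval₂_X,
          RingHom.id_apply]
        rw [← Algebra.commutes, ← Algebra.smul_def, smul_smul, mul_comm]
      rw [hP, map_mul, map_pow, map_pow, hl, hl]
    rw [← h1, eval₂_eq_sum_range' (n := P.natDegree + 4) _ (by omega)]
    apply Finset.sum_congr rfl
    intro k _
    rw [← map_pow, RingHom.id_apply, ← Algebra.commutes, ← Algebra.smul_def]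
  have hTf : (fun z => T (f z)) =
      fun z : ℂ => ∑ k ∈ Finset.range (P.natDegree + 4), z ^ k • T (P.coeff k) := by
    ext z
    rw [hfP, map_sum]
    simp
  obtain ⟨G1, G2, G3, hG, hG1, hG2, hG3, e1, e2, e3⟩ :=
    polyfun_deriv (fun k => T (P.coeff k)) P.natDegree
  rw [← hTf] at hG
  simp_rw [← hTf] at hG1
  have hsmall : ∀ z ∈ Metric.ball (0:ℂ) (n / D), ∀ c : B, ‖c‖ ≤ D - 1 →
      ‖((n:ℂ)⁻¹ * z) • c‖ < 1 := by
    intro z hz c hc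
    rw [mem_ball_zero_iff, lt_div_iff₀ (by linarith)] at hz
    rw [norm_smul, norm_mul, norm_inv, Complex.norm_natCast, mul_assoc, inv_mul_lt_iff₀ hn0, mul_one]
    refine lt_of_le_of_lt ?_ hz
    gcongr
    linarith
  have ha : ‖a‖ ≤ D - 1 := by have := norm_nonneg b; linarith
  have hb : ‖b‖ ≤ D - 1 := by have := norm_nonneg a; linarith
  have hunit : ∀ x : B, ‖x‖ < 1 → IsUnit (1 + x) := fun x hx => by
    have := isUnit_one_sub_of_norm_lt_one (x := -x) (by rwa [norm_neg])
    simpa using this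
  have hres := coeff_bounds φ hφ hφ1 hpos hstar (fun z => T (f z)) G1 G2 G3 hG hG1 hG2 hG3 (n / D)
    (by positivity) (fun z hz => hTinv _
      (((hunit _ (hsmall z hz a ha)).pow n).mul ((hunit _ (hsmall z hz b hb)).pow n)))
    (by simp [hf, hT1]) (K * n) (by positivity) (fun z hz => by
      have hexp : Real.exp (K * n) = Q ^ n := by
        rw [mul_comm, Real.exp_nat_mul, Real.exp_log (by linarith)]
      rw [hexp]
      refine iSup₂_le fun l hl => ?_
      rw [← ENNReal.ofReal_coe_nnreal, coe_nnnorm]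
      apply ENNReal.ofReal_le_ofReal
      have hl2 : l ∈ spectrum ℂ (f z) := by
        rw [spectrum.mem_iff] at hl ⊢
        intro h
        apply hl
        have := hTinv _ h
        rwa [map_sub, Algebra.algebraMap_eq_smul_one, map_smul, hT1,
          ← Algebra.algebraMap_eq_smul_one] at this
      refine (spectrum.norm_le_norm_mul_of_mem hl2).trans ?_
      have b1 := norm_one_add_pow_mul_le _ ((1 + ((n:ℂ)⁻¹ * z) • b) ^ n) (hsmall z hz a ha).le n
      have b2 := norm_one_add_pow_mul_le _ (1:B) (hsmall z hz b hb).le n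
      rw [mul_one] at b2
      calc ‖f z‖ * ‖(1:B)‖ ≤ (2 ^ n * (2 ^ n * ‖(1:B)‖)) * ‖(1:B)‖ := by
            gcongr
            exact b1.trans (by gcongr)
        _ = 4 ^ n * (‖(1:B)‖ ^ 2) ^ 1 := by
            rw [show (4:ℝ) = 2 * 2 by norm_num, mul_pow]; ring
        _ ≤ 4 ^ n * (‖(1:B)‖ ^ 2) ^ n := by
            gcongr
            nlinarith
        _ = Q ^ n := by rw [hQ, mul_pow])
  rw [e1, e2, e3] at hres
  simp only [map_smul, smul_eq_mul, mul_smul_comm] at hres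
  obtain ⟨r1, r2⟩ := hres
  refine ⟨r1.trans ?_, ?_⟩
  · rw [div_pow, div_div_eq_mul_div, div_le_div_iff₀ (by positivity) hn0]
    have : D ^ 2 ≤ D ^ 3 := pow_le_pow_right₀ hD1 (by norm_num)
    nlinarith [mul_nonneg (mul_nonneg hK0.le (sq_nonneg (n:ℝ))) (sub_nonneg.2 this),
      mul_nonneg (mul_nonneg hK0.le (sq_nonneg (n:ℝ))) (sq_nonneg D)]
  · have e : (3:ℂ) * (2 * φ (T (P.coeff 1) * T (P.coeff 2)))
      = 6 * φ (T (P.coeff 1) * T (P.coeff 2)) := by ring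
    rw [e] at r2
    refine r2.trans ?_
    rw [div_pow, div_div_eq_mul_div, div_le_div_iff₀ (by positivity) hn0]
    have : (n:ℝ) ^ 2 ≤ n ^ 3 := pow_le_pow_right₀ hnr (by norm_num)
    nlinarith [mul_nonneg (mul_nonneg hK0.le (pow_nonneg (zero_le_one.trans hD1) 3)) (sub_nonneg.2 this)]

open Filter Topology in
theorem eq_zero_of_bound (x y w : ℂ) (E : ℝ)
    (h : ∀ n : ℕ, 1 ≤ n → ‖x + y * (n:ℂ)⁻¹ + w * ((n:ℂ)⁻¹) ^ 2‖ ≤ E / n) : x = 0 := by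
  have h1 : Tendsto (fun n : ℕ => ((n:ℂ)⁻¹)) atTop (𝓝 0) := tendsto_inv_atTop_nhds_zero_nat
  have h2 : Tendsto (fun n : ℕ => ‖x + y * (n:ℂ)⁻¹ + w * ((n:ℂ)⁻¹) ^ 2‖) atTop (𝓝 ‖x‖) := by
    simpa using (((h1.const_mul y).const_add x).add ((h1.pow 2).const_mul w)).norm
  have h3 : Tendsto (fun n : ℕ => E / (n:ℝ)) atTop (𝓝 0) := tendsto_const_div_atTop_nhds_zero_nat E
  have := le_of_tendsto_of_tendsto h2 h3 (by
    filter_upwards [eventually_ge_atTop 1] with n hn using h n hn)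
  exact norm_le_zero_iff.1 this

open Polynomial in
theorem identities [PartialOrder A] [StarOrderedRing A] (φ : A →L[ℂ] ℂ)
    (hφ : ∀ a b, φ (a * b) = φ (b * a)) (hφ1 : φ 1 = 1) (hpos : ∀ a, 0 ≤ a → 0 ≤ φ a)
    (hstar : ∀ a, φ (star a) = star (φ a))
    {B : Type*} [NormedRing B] [NormedAlgebra ℂ B] [CompleteSpace B]
    (T : B →ₗ[ℂ] A) (hT1 : T 1 = 1) (hTinv : ∀ x : B, IsUnit x → IsUnit (T x)) (a b : B) :
    φ (T (a * a)) + φ (T (b * b)) + 2 * φ (T (a * b)) - φ (T (a + b) * T (a + b)) = 0 ∧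
    φ (T (a * a * a)) - 3 * φ (T a * T (a * a)) + 2 * φ (T a * T a * T a) = 0 := by
  have c2 : ∀ n : ℕ, 1 ≤ n → ((n.choose 2 : ℕ) : ℂ) * ((n:ℂ)⁻¹) ^ 2 = (1 - (n:ℂ)⁻¹) / 2 := by
    intro n hn
    have : (n:ℂ) ≠ 0 := by exact_mod_cast (by omega : n ≠ 0)
    rw [Nat.cast_choose_two]
    field_simp
  have c3 : ∀ n : ℕ, 1 ≤ n → ((n.choose 3 : ℕ) : ℂ) * ((n:ℂ)⁻¹) ^ 3
      = (1 - (n:ℂ)⁻¹) * (1 - 2 * (n:ℂ)⁻¹) / 6 := by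
    intro n hn
    have h0 : (n:ℂ) ≠ 0 := by exact_mod_cast (by omega : n ≠ 0)
    have h1 : ((n.choose 3 : ℕ) : ℂ) * 3 = (n.choose 2 : ℕ) * ((n:ℂ) - 2) := by
      rcases Nat.lt_or_ge n 2 with h | h
      · rw [Nat.choose_eq_zero_of_lt h, Nat.choose_eq_zero_of_lt (by omega)]; simp
      · have := Nat.choose_succ_right_eq n 2
        have h' : ((n - 2 : ℕ) : ℂ) = (n:ℂ) - 2 := by rw [Nat.cast_sub h]; norm_num
        rw [← h']
        exact_mod_cast this
    have h2 : ((n.choose 3 : ℕ) : ℂ) = (n:ℂ) * (n - 1) * (n - 2) / 6 := by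
      rw [Nat.cast_choose_two] at h1
      linear_combination h1 / 3
    rw [h2]
    field_simp
  have cf : ∀ (n k : ℕ) (c : B), ((1 + C ((n:ℂ)⁻¹ • c) * X : B[X]) ^ n).coeff k
      = (((n.choose k : ℕ) : ℂ) * ((n:ℂ)⁻¹) ^ k) • c ^ k := by
    intro n k c
    rw [coeff_one_add_pow, _root_.smul_pow, ← nsmul_eq_mul, ← Nat.cast_smul_eq_nsmul ℂ, smul_smul]
  have cf1 : ∀ (n : ℕ) (c : B), 1 ≤ n → ((1 + C ((n:ℂ)⁻¹ • c) * X : B[X]) ^ n).coeff 1 = c := by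
    intro n c hn
    have : (n:ℂ) ≠ 0 := by exact_mod_cast (by omega : n ≠ 0)
    rw [cf]; simp [this]
  have cf0 : ∀ (n : ℕ) (c : B), ((1 + C ((n:ℂ)⁻¹ • c) * X : B[X]) ^ n).coeff 0 = 1 := by
    intro n c
    rw [cf]; simp
  constructor
  · obtain ⟨E, hE⟩ := main_bound φ hφ hφ1 hpos hstar T hT1 hTinv a b
    refine eq_zero_of_bound _ (-(φ (T (a * a)) + φ (T (b * b)))) 0 E fun n hn => ?_
    have := (hE n hn _ rfl).1
    have e2 : ((1 + C ((n:ℂ)⁻¹ • a) * X : B[X]) ^ n * (1 + C ((n:ℂ)⁻¹ • b) * X) ^ n).coeff 2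
        = ((1 - (n:ℂ)⁻¹) / 2) • (b * b) + (a * b + ((1 - (n:ℂ)⁻¹) / 2) • (a * a)) := by
      rw [coeff_mul, Finset.Nat.sum_antidiagonal_eq_sum_range_succ_mk, Finset.sum_range_succ,
        Finset.sum_range_succ, Finset.sum_range_one]
      simp only [Nat.sub_zero, Nat.sub_self, Nat.add_one_sub_one, Nat.succ_eq_add_one, cf0,
        cf1 _ _ hn, one_mul, mul_one, zero_add]
      rw [cf, cf, c2 n hn, sq, sq, add_assoc]
    have e1 : ((1 + C ((n:ℂ)⁻¹ • a) * X : B[X]) ^ n * (1 + C ((n:ℂ)⁻¹ • b) * X) ^ n).coeff 1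
        = a + b := by
      rw [coeff_mul, Finset.Nat.antidiagonal_succ]
      simp [cf0, cf1 _ _ hn, add_comm]
    rw [e1, e2] at this
    refine le_trans (le_of_eq ?_) this
    congr 1
    simp only [map_add, map_smul, smul_eq_mul]
    ring
  · obtain ⟨E, hE⟩ := main_bound φ hφ hφ1 hpos hstar T hT1 hTinv a 0
    refine eq_zero_of_bound _ (-3 * φ (T (a * a * a)) + 3 * φ (T a * T (a * a)))
      (2 * φ (T (a * a * a))) E fun n hn => ?_
    have := (hE n hn _ rfl).2
    simp only [smul_zero, map_zero, zero_mul, add_zero, one_pow, mul_one] at this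
    rw [cf1 _ _ hn, cf, cf, c2 n hn, c3 n hn] at this
    refine le_trans (le_of_eq ?_) this
    congr 1
    have p3 : a ^ 3 = a * a * a := by rw [pow_succ, sq]
    rw [p3, sq a]
    simp only [map_smul, smul_eq_mul, mul_smul_comm]
    ring

theorem final_form [PartialOrder A] [StarOrderedRing A] (φ : A →L[ℂ] ℂ)
    (hφ : ∀ a b, φ (a * b) = φ (b * a)) (hφ1 : φ 1 = 1) (hpos : ∀ a, 0 ≤ a → 0 ≤ φ a)
    (hstar : ∀ a, φ (star a) = star (φ a))
    {B : Type*} [NormedRing B] [NormedAlgebra ℂ B] [CompleteSpace B]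
    (T : B →ₗ[ℂ] A) (hT1 : T 1 = 1) (hTinv : ∀ x : B, IsUnit x → IsUnit (T x)) (a b : B) :
    φ (T a * T a * T b) = φ (T (a * a) * T b) := by
  have hI := fun a b => identities φ hφ hφ1 hpos hstar T hT1 hTinv a b
  have hsq : ∀ a : B, φ (T (a * a)) = φ (T a * T a) := by
    intro a
    have := (hI a 0).1
    simp only [mul_zero, map_zero, add_zero] at this
    linear_combination this
  have hmul : ∀ a b : B, φ (T (a * b)) = φ (T a * T b) := by
    intro a b
    have := (hI a b).1
    simp only [map_add, add_mul, mul_add, hsq, hφ (T b) (T a)] at this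
    linear_combination this / 2
  have hcub : ∀ a : B, φ (T a * T a * T a) = φ (T (a * a * a)) := by
    intro a
    have h := (hI a 0).2
    rw [← hmul, ← mul_assoc] at h
    linear_combination h / 2
  have q1 := hcub (a + b)
  have q2 := hcub (a - b)
  have q3 := hcub b
  have t1 : φ (T a * T b * T a) = φ (T a * T a * T b) := by rw [hφ, mul_assoc]
  have t2 : φ (T b * T a * T a) = φ (T a * T a * T b) := by rw [mul_assoc, hφ]
  have s1 : φ (T (a * b * a)) = φ (T (a * a * b)) := by
    rw [hmul, hφ, ← hmul, mul_assoc]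
  have s2 : φ (T (b * a * a)) = φ (T (a * a * b)) := by
    rw [mul_assoc, hmul, hφ, ← hmul]
  rw [← hmul]
  simp only [map_add, map_sub, add_mul, mul_add, sub_mul, mul_sub] at q1 q2
  linear_combination (q1 - q2 - 2 * q3) / 6 - (t1 + t2) / 3 + (s1 + s2) / 3
end FK

/-- For a surjective unital invertibility-preserving linear map `T` into a unital
C*-algebra with faithful tracial state `τ`, one has `τ ((Ta)² Tb) = τ (T(a²) Tb)`. -/
theorem trace_sq_map_eq_trace_map_sq
    {B A : Type*} [NormedRing B] [NormedAlgebra ℂ B] [CompleteSpace B]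
    [CStarAlgebra A]
    (τ : A →ₗ[ℂ] ℂ)
    (hτ1 : τ 1 = 1)
    (hτtrace : ∀ a b : A, τ (a * b) = τ (b * a))
    (hτpos : ∀ a : A, 0 ≤ τ (star a * a))
    (hτfaithful : ∀ a : A, τ (star a * a) = 0 → a = 0)
    (T : B →ₗ[ℂ] A)
    (hTsurj : Function.Surjective T)
    (hT1 : T 1 = 1)
    (hTinv : ∀ x : B, IsUnit x → IsUnit (T x)) :
    ∀ a b : B, τ (T a * T a * T b) = τ (T (a * a) * T b) := by
  let _ : PartialOrder A := CStarAlgebra.spectralOrder A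
  have : StarOrderedRing A := CStarAlgebra.spectralOrderedRing A
  have hpos : ∀ a : A, 0 ≤ a → 0 ≤ τ a := by
    intro a ha
    obtain ⟨x, rfl⟩ := CStarAlgebra.nonneg_iff_eq_star_mul_self.1 ha
    exact hτpos x
  let p : A →ₚ[ℂ] ℂ := PositiveLinearMap.mk₀ τ hpos
  have hcont : Continuous τ := (map_continuous p : Continuous p)
  have hstar : ∀ a, τ (star a) = star (τ a) := fun a => map_star p a
  intro a b
  exact final_form ⟨τ, hcont⟩ hτtrace hτ1 hpos hstar T hT1 hTinv a b
end

section
/- Let A be a unital C*-algebra and let τ be a tracial state on A. Then τ is a spectral state: for every a ∈ A, τ(a) lies in the convex hull of the spectrum σ(a) of a; in particular |τ(a)| ≤ ρ(a), where ρ denotes the spectral radius. -/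
open scoped ComplexOrder ENNReal

theorem aux_isCompact_hull {s : Set ℂ} (hs : IsCompact s) : IsCompact (convexHull ℝ s) := by
  let F : (ℝ × ℝ) × (ℂ × ℂ × ℂ) → ℂ := fun p =>
    (1 - p.1.1) • p.2.1 + p.1.1 • ((1 - p.1.2) • p.2.2.1 + p.1.2 • p.2.2.2)
  have hF : Continuous F := by fun_prop
  have hK : IsCompact (F '' ((Set.Icc (0:ℝ) 1 ×ˢ Set.Icc (0:ℝ) 1) ×ˢ (s ×ˢ s ×ˢ s))) :=
    (((isCompact_Icc.prod isCompact_Icc).prod (hs.prod (hs.prod hs)))).image hF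
  convert hK using 1
  apply Set.Subset.antisymm
  · intro x hx
    rw [convexHull_eq_union] at hx
    simp only [Set.mem_iUnion] at hx
    obtain ⟨t, hts, hti, hxt⟩ := hx
    have hcard : t.card ≤ 3 := by
      have h1 := hti.card_le_finrank_succ
      have h2 : Module.finrank ℝ (vectorSpan ℝ (Set.range ((↑) : t → ℂ))) ≤ 2 :=
        (Submodule.finrank_le _).trans (by simp)
      simp only [Fintype.card_coe] at h1
      omega
    have hne : t.Nonempty := by
      rw [← Finset.coe_nonempty, ← @convexHull_nonempty_iff ℝ]
      exact ⟨x, hxt⟩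
    have key : ∃ a ∈ s, ∃ b ∈ s, ∃ c ∈ s, (t : Set ℂ) ⊆ {a, b, c} := by
      have h0 := hne.card_pos
      have : t.card = 1 ∨ t.card = 2 ∨ t.card = 3 := by omega
      rcases this with h | h | h
      · obtain ⟨a, rfl⟩ := Finset.card_eq_one.1 h
        have ha : a ∈ s := hts (by simp)
        exact ⟨a, ha, a, ha, a, ha, by simp⟩
      · obtain ⟨a, b, -, rfl⟩ := Finset.card_eq_two.1 h
        have ha : a ∈ s := hts (by simp)
        have hb : b ∈ s := hts (by simp)
        exact ⟨a, ha, b, hb, b, hb, by simp⟩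
      · obtain ⟨a, b, c, -, -, -, rfl⟩ := Finset.card_eq_three.1 h
        have ha : a ∈ s := hts (by simp)
        have hb : b ∈ s := hts (by simp)
        have hc : c ∈ s := hts (by simp)
        exact ⟨a, ha, b, hb, c, hc, by simp⟩
    obtain ⟨a, ha, b, hb, c, hc, habc⟩ := key
    have hx2 : x ∈ convexHull ℝ ({a, b, c} : Set ℂ) := convexHull_mono habc hxt
    rw [convexHull_insert (by simp), convexHull_pair, convexJoin_singleton_left] at hx2
    simp only [Set.mem_iUnion] at hx2
    obtain ⟨y, hy, hxy⟩ := hx2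
    rw [segment_eq_image] at hy hxy
    obtain ⟨v, hv, rfl⟩ := hy
    obtain ⟨w, hw, rfl⟩ := hxy
    exact ⟨((w, v), (a, b, c)), ⟨⟨hw, hv⟩, ha, hb, hc⟩, rfl⟩
  · rintro _ ⟨⟨⟨w, v⟩, a, b, c⟩, ⟨⟨hw, hv⟩, ha, hb, hc⟩, rfl⟩
    have hcv := convex_convexHull ℝ s
    simp only at hw hv ha hb hc
    refine hcv (subset_convexHull ℝ s ha) (hcv (subset_convexHull ℝ s hb)
      (subset_convexHull ℝ s hc) ?_ hv.1 ?_) ?_ hw.1 ?_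
    · linarith [hv.2]
    · simp
    · linarith [hw.2]
    · simp

section
variable {A : Type*} [CStarAlgebra A] (τ : A →ₗ[ℂ] ℂ)

theorem aux_star (hτpos : ∀ a : A, 0 ≤ τ (star a * a)) (x : A) :
    τ (star x) = star (τ x) := by
  have im0 : ∀ y, (τ (star y * y)).im = 0 := fun y => ((Complex.nonneg_iff.1 (hτpos y)).2).symm
  have h0 := im0 1
  have h1 := im0 x
  have h2 := im0 (1 + x)
  have h3 := im0 (1 + Complex.I • x)
  simp [add_mul, mul_add] at h0 h1 h2 h3
  apply Complex.ext <;> simp <;> linarith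

theorem aux_cs (hτ1 : τ 1 = 1) (hτpos : ∀ a : A, 0 ≤ τ (star a * a)) (c : A)
    (hc : (τ (star c * c)).re ≤ 1) : ‖τ c‖ ≤ 1 := by
  have h := (Complex.nonneg_iff.1 (hτpos (c - (τ c) • (1 : A)))).1
  simp [sub_mul, mul_sub, hτ1, aux_star τ hτpos] at h
  have h2 : ‖τ c‖ ^ 2 = (τ c).re ^ 2 + (τ c).im ^ 2 := by
    rw [← Complex.normSq_eq_norm_sq, Complex.normSq_apply]; ring
  nlinarith [norm_nonneg (τ c)]

theorem aux_key (hτ1 : τ 1 = 1)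
    (hτtrace : ∀ a b : A, τ (a * b) = τ (b * a))
    (hτpos : ∀ a : A, 0 ≤ τ (star a * a)) (a : A) (n : ℕ) (hn : n ≠ 0) (ha : ‖a ^ n‖ ≤ 1) :
    ‖τ a‖ ≤ 1 := by
  let _ := CStarAlgebra.spectralOrder A
  have := CStarAlgebra.spectralOrderedRing A
  obtain ⟨m, rfl⟩ := Nat.exists_eq_succ_of_ne_zero hn
  set h : A := ∑ k ∈ Finset.range (m + 1), star (a ^ k) * a ^ k with hh
  have h1 : 1 ≤ h := by
    rw [hh, Finset.sum_range_succ']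
    simp only [pow_zero, star_one, mul_one]
    exact le_add_of_nonneg_left (Finset.sum_nonneg fun i _ => star_mul_self_nonneg _)
  have h0 : 0 ≤ h := zero_le_one.trans h1
  have hN : star (a ^ (m + 1)) * a ^ (m + 1) ≤ 1 := by
    rw [← CStarAlgebra.norm_le_one_iff_of_nonneg _ (star_mul_self_nonneg _),
      CStarRing.norm_star_mul_self]
    exact mul_le_one₀ ha (norm_nonneg _) ha
  have hle : star a * h * a ≤ h := by
    have e : star a * h * a + 1 = h + star (a ^ (m + 1)) * a ^ (m + 1) := by
      rw [hh, ← Finset.sum_range_succ (fun k => star (a ^ k) * a ^ k),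
        Finset.sum_range_succ' _ (m + 1), Finset.mul_sum, Finset.sum_mul]
      simp only [pow_zero, star_one, mul_one]
      congr 1
      refine Finset.sum_congr rfl fun k _ => ?_
      rw [pow_succ, star_mul]
      simp only [mul_assoc]
    have : star a * h * a + 1 ≤ h + 1 := by rw [e]; gcongr
    exact le_of_add_le_add_right this
  have hu : IsUnit (CFC.sqrt h) := (CFC.isUnit_sqrt_iff h h0).2 (CStarAlgebra.isUnit_of_le 1 h1)
  obtain ⟨b, hb⟩ := hu
  have hbb : (b : A) * b = h := by rw [hb]; exact CFC.sqrt_mul_sqrt_self h h0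
  have hbs : star (b : A) = b := by
    rw [hb]; exact (IsSelfAdjoint.of_nonneg (CFC.sqrt_nonneg h)).star_eq
  have hbis : star ((b⁻¹ : Aˣ) : A) = ((b⁻¹ : Aˣ) : A) := by
    have : star b = b := Units.ext hbs
    rw [← Units.coe_star, star_inv, this]
  set d : A := ((b⁻¹ : Aˣ) : A) with hd
  have hτc : τ (b * a * d) = τ a := by
    rw [hτtrace, ← mul_assoc, hd, Units.inv_mul, one_mul]
  rw [← hτc]
  apply aux_cs τ hτ1 hτpos
  have hcc : star (b * a * d) * (b * a * d) = star d * (star a * h * a) * d := by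
    rw [star_mul, star_mul, hbs, ← hbb]; simp only [mul_assoc]
  have hdd : star d * h * d = 1 := by
    rw [hbis, ← hbb, hd, ← mul_assoc, Units.inv_mul, one_mul, Units.mul_inv]
  have hfin : star (b * a * d) * (b * a * d) ≤ 1 := by
    rw [hcc, ← hdd]
    exact star_left_conjugate_le_conjugate hle d
  obtain ⟨s, hs⟩ := CStarAlgebra.nonneg_iff_eq_star_mul_self.1 (sub_nonneg.2 hfin)
  have := (Complex.nonneg_iff.1 (hτpos s)).1
  rw [← hs, map_sub, hτ1] at this
  simp only [Complex.sub_re, Complex.one_re] at this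
  linarith

theorem aux_rad (hτ1 : τ 1 = 1)
    (hτtrace : ∀ a b : A, τ (a * b) = τ (b * a))
    (hτpos : ∀ a : A, 0 ≤ τ (star a * a)) (a : A) (r : ℝ) (hr : 0 < r)
    (ha : ∀ z ∈ spectrum ℂ a, ‖z‖ < r) : ‖τ a‖ ≤ r := by
  have : Nontrivial A := ⟨1, 0, fun h => by rw [h] at hτ1; simp at hτ1⟩
  set k : ℂ := (r : ℂ)⁻¹ with hk
  have hρ : spectralRadius ℂ (k • a) < (1 : NNReal) := by
    apply spectrum.spectralRadius_lt_of_forall_lt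
    intro z hz
    rw [spectrum.smul_eq_smul _ _ (spectrum.nonempty a)] at hz
    obtain ⟨y, hy, rfl⟩ := hz
    rw [← NNReal.coe_lt_coe]
    have := ha y hy
    simp only [smul_eq_mul, nnnorm_mul, NNReal.coe_mul, coe_nnnorm, NNReal.coe_one, hk, norm_inv,
      Complex.norm_real, Real.norm_eq_abs, abs_of_pos hr]
    rw [inv_mul_lt_iff₀ hr]; linarith
  have hT := (spectrum.pow_nnnorm_pow_one_div_tendsto_nhds_spectralRadius (k • a)).eventually
    (gt_mem_nhds hρ)
  obtain ⟨n, hn1, hn2⟩ := (hT.and (Filter.eventually_ge_atTop 1)).exists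
  have hle : ‖(k • a) ^ n‖ ≤ 1 := by
    by_contra hcon
    push Not at hcon
    have : (1 : ℝ≥0∞) ≤ (‖(k • a) ^ n‖₊ : ℝ≥0∞) := by
      rw [ENNReal.one_le_coe_iff]; exact_mod_cast hcon.le
    have := ENNReal.one_le_rpow this (z := 1 / (n : ℝ)) (by positivity)
    exact absurd hn1 (not_lt.2 (by simpa using this))
  have := aux_key τ hτ1 hτtrace hτpos (k • a) n (by omega) hle
  rw [map_smul, norm_smul, hk, norm_inv, Complex.norm_real, Real.norm_eq_abs, abs_of_pos hr,
    inv_mul_le_iff₀ hr] at this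
  linarith

theorem aux_hull (hτ1 : τ 1 = 1)
    (hτtrace : ∀ a b : A, τ (a * b) = τ (b * a))
    (hτpos : ∀ a : A, 0 ≤ τ (star a * a)) (a : A) :
    τ a ∈ convexHull ℝ (spectrum ℂ a) := by
  have : Nontrivial A := ⟨1, 0, fun h => by rw [h] at hτ1; simp at hτ1⟩
  by_contra hcon
  obtain ⟨f, u, hfu, huf⟩ := geometric_hahn_banach_closed_point (convex_convexHull ℝ _)
    (aux_isCompact_hull (spectrum.isCompact (𝕜 := ℂ) a)).isClosed hcon
  set w : ℂ := ⟨f 1, - f Complex.I⟩ with hw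
  have hf : ∀ z : ℂ, f z = (w * z).re := by
    intro z
    have hz : z = z.re • (1 : ℂ) + z.im • Complex.I := by
      apply Complex.ext <;> simp
    conv_lhs => rw [hz]
    rw [map_add, map_smul, map_smul]
    simp [hw, Complex.mul_re]; ring
  rw [hf] at huf
  set v := (w * τ a).re with hv
  set M := ‖w‖ * ‖a‖ with hM
  have hM0 : 0 ≤ M := by positivity
  set t := M + |u| + |v| + 1 + M ^ 2 / (v - u) with ht
  have hvu : 0 < v - u := by linarith
  have hq : 0 ≤ M ^ 2 / (v - u) := by positivity
  have hq2 : M ^ 2 / (v - u) * (v - u) = M ^ 2 := by field_simp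
  have hu1 := neg_abs_le u
  have hv1 := neg_abs_le v
  have hu2 := abs_nonneg u
  have hv2 := abs_nonneg v
  have hut : 0 < u + t := by linarith
  have hvt : 0 < v + t := by linarith
  have hpos : 0 < (u + t) ^ 2 + M ^ 2 := by positivity
  have key := aux_rad τ hτ1 hτtrace hτpos (w • a + algebraMap ℂ A (t : ℂ))
    (Real.sqrt ((u + t) ^ 2 + M ^ 2)) (Real.sqrt_pos.2 hpos) (by
      intro z hz
      rw [← spectrum.add_singleton_eq, spectrum.smul_eq_smul _ _ (spectrum.nonempty a)] at hz
      obtain ⟨_, ⟨y, hy, rfl⟩, _, rfl, rfl⟩ := hz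
      have h1 : (w * y).re < u := by rw [← hf]; exact hfu y (subset_convexHull ℝ _ hy)
      have hn : ‖w * y‖ ≤ M := by
        rw [norm_mul, hM]; exact mul_le_mul_of_nonneg_left (spectrum.norm_le_norm_of_mem hy) (norm_nonneg _)
      have h2 := abs_le.1 ((Complex.abs_re_le_norm _).trans hn)
      have h3 := abs_le.1 ((Complex.abs_im_le_norm _).trans hn)
      apply Real.lt_sqrt_of_sq_lt
      simp only [smul_eq_mul]
      rw [← Complex.normSq_eq_norm_sq, Complex.normSq_apply]
      simp only [Complex.add_re, Complex.add_im, Complex.ofReal_re, Complex.ofReal_im, add_zero]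
      have h4 : 0 ≤ (w * y).re + t := by linarith [h2.1]
      nlinarith [h3.1, h3.2])
  have h5 : v + t ≤ Real.sqrt ((u + t) ^ 2 + M ^ 2) := by
    refine le_trans ?_ key
    refine le_trans (le_of_eq ?_) (Complex.re_le_norm _)
    rw [map_add, map_smul, Algebra.algebraMap_eq_smul_one, map_smul, hτ1]
    simp [hv]
  have h6 : (v + t) ^ 2 ≤ (u + t) ^ 2 + M ^ 2 := (Real.le_sqrt' hvt).1 h5
  have h7 : (v - u) * (v + u + 2 * t) ≤ M ^ 2 := by nlinarith
  have h8 : M ^ 2 / (v - u) < v + u + 2 * t := by linarith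
  nlinarith
end

/-- Every tracial state on a unital C*-algebra is a spectral state: `τ a` lies in the
convex hull of the spectrum of `a`, and in particular `|τ a| ≤ ρ(a)`. -/
theorem tracial_state_is_spectral_state
    {A : Type*} [CStarAlgebra A]
    (τ : A →ₗ[ℂ] ℂ)
    (hτ1 : τ 1 = 1)
    (hτtrace : ∀ a b : A, τ (a * b) = τ (b * a))
    (hτpos : ∀ a : A, 0 ≤ τ (star a * a)) :
    ∀ a : A, τ a ∈ convexHull ℝ (spectrum ℂ a) ∧
      (‖τ a‖₊ : ℝ≥0∞) ≤ spectralRadius ℂ a := by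
  intro a
  have : Nontrivial A := ⟨1, 0, fun h => by rw [h] at hτ1; simp at hτ1⟩
  have h := aux_hull τ hτ1 hτtrace hτpos a
  refine ⟨h, ?_⟩
  obtain ⟨z, hz, hzr⟩ := spectrum.exists_nnnorm_eq_spectralRadius a
  rw [← hzr]
  have hsub : convexHull ℝ (spectrum ℂ a) ⊆ Metric.closedBall 0 ‖z‖ := by
    refine convexHull_min (fun y hy => ?_) (convex_closedBall _ _)
    have h1 : (‖y‖₊ : ℝ≥0∞) ≤ spectralRadius ℂ a :=
      le_iSup₂ (f := fun k (_ : k ∈ spectrum ℂ a) => (‖k‖₊ : ℝ≥0∞)) y hy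
    rw [← hzr, ENNReal.coe_le_coe] at h1
    rw [mem_closedBall_zero_iff]
    exact_mod_cast h1
  have h2 := hsub h
  rw [mem_closedBall_zero_iff] at h2
  rw [ENNReal.coe_le_coe]
  exact_mod_cast h2
end
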